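/- arXiv:2307.11029 — 2 statements merged into one kernel-verified Lean document; each statement's English description precedes it below -/
import Mathlib

section
/- The connected-graph analogue of the divided-difference formula holds: the free cumulant function of m satisfies m_∘[z_1,...,z_k] = (∏_{s=1}^{k} m(z_s)) · Σ_{Γ ∈ NCG_c(k)} ∏_{(i,j) ∈ E(Γ)} q_{i,j}, where NCG_c(k) are the connected disk non-crossing graphs. -/
open MeasureTheory

/-- The semicircle density `ρ_sc(x) = √(4 - x²) / (2π)` on `[-2, 2]`. -/
noncomputable def rhoSc (x : ℝ) : ℝ := Real.sqrt (4 - x ^ 2) / (2 * Real.pi)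

/-- The Stieltjes transform of the semicircle distribution, with the sign convention
`m(z) = (√(z² - 4) - z)/2`. -/
noncomputable def msc (z : ℂ) : ℂ := ∫ x in (-2 : ℝ)..2, (rhoSc x : ℂ) / ((x : ℂ) - z)

open Finset

/-- A graph on the cyclically ordered vertex set `Fin k` is (disk) non-crossing. -/
def IsNCGraph {k : ℕ} (G : SimpleGraph (Fin k)) : Prop :=
  ∀ a b c d : Fin k, a < c → c < b → b < d → G.Adj a b → G.Adj c d → False

/-- The edge weight `q_{i,j} = m(z_i) m(z_j) / (1 - m(z_i) m(z_j))`, as a function on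
unordered pairs. -/
noncomputable def qweight {k : ℕ} (z : Fin k → ℂ) : Sym2 (Fin k) → ℂ :=
  Sym2.lift ⟨fun i j => msc (z i) * msc (z j) / (1 - msc (z i) * msc (z j)),
    fun i j => by simp only []; rw [mul_comm (msc (z i)) (msc (z j))]⟩

/-- Two elements lie in the same block of a finpartition. -/
def SameBlock {α : Type*} [DecidableEq α] {s : Finset α} (π : Finpartition s) (a b : α) : Prop :=
  ∃ B ∈ π.parts, a ∈ B ∧ b ∈ B

/-- A partition of a subset of the linearly ordered set `Fin k` is non-crossing. -/
def IsNoncrossing {k : ℕ} {s : Finset (Fin k)} (π : Finpartition s) : Prop :=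
  ∀ a b c d : Fin k, a < c → c < b → b < d →
    SameBlock π a b → SameBlock π c d → SameBlock π a c


/-- Off the real axis, `z` is the image under the Joukowski map of a point of the open unit disc. -/
theorem exists_joukowski {z : ℂ} (hz : z.im ≠ 0) :
    ∃ ζ : ℂ, ζ ≠ 0 ∧ ‖ζ‖ < 1 ∧ z = ζ + ζ⁻¹ := by
  obtain ⟨s, hs⟩ := IsAlgClosed.exists_pow_nat_eq (z ^ 2 - 4) (n := 2) (by norm_num)
  set ζ : ℂ := (z + s) / 2 with hζ
  have hmul : ζ * ((z - s) / 2) = 1 := by rw [hζ]; linear_combination (-1 / 4 : ℂ) * hs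
  have h0 : ζ ≠ 0 := left_ne_zero_of_mul_eq_one hmul
  have hinv : ζ⁻¹ = (z - s) / 2 := inv_eq_of_mul_eq_one_right hmul
  have hsum : z = ζ + ζ⁻¹ := by rw [hinv, hζ]; ring
  have hne : ‖ζ‖ ≠ 1 := by
    intro h
    apply hz
    rw [hsum, Complex.inv_eq_conj h]
    simp
  rcases lt_or_gt_of_ne hne with h | h
  · exact ⟨ζ, h0, h, hsum⟩
  · refine ⟨ζ⁻¹, inv_ne_zero h0, ?_, ?_⟩
    · rw [norm_inv]; exact inv_lt_one_of_one_lt₀ h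
    · rw [inv_inv, add_comm]; exact hsum

theorem ofReal_sub_ne_zero {z : ℂ} (hz : z.im ≠ 0) (x : ℝ) : (x : ℂ) - z ≠ 0 := by
  intro h
  apply hz
  rw [← sub_eq_zero.mp h]
  exact Complex.ofReal_im x

theorem integral_inv_two_cos_sub {z ζ : ℂ} (hz : z.im ≠ 0) (h0 : ζ ≠ 0) (h1 : ‖ζ‖ < 1)
    (hsum : z = ζ + ζ⁻¹) :
    ∫ θ in (0 : ℝ)..Real.pi, (((2 * Real.cos θ : ℝ) : ℂ) - z)⁻¹ = Real.pi * (ζ - ζ⁻¹)⁻¹ := by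
  set f : ℝ → ℂ := fun θ => (((2 * Real.cos θ : ℝ) : ℂ) - z)⁻¹ with hf
  have hcont : Continuous f := by
    refine Continuous.inv₀ (by fun_prop) fun θ => ofReal_sub_ne_zero hz _
  have hI : ∮ w in C(0, 1), (w - ζ)⁻¹ • (w - ζ⁻¹)⁻¹ =
      (2 * Real.pi * Complex.I) • (ζ - ζ⁻¹)⁻¹ := by
    have hne : ∀ w ∈ Metric.closedBall (0 : ℂ) 1, w - ζ⁻¹ ≠ 0 := by
      intro w hw h
      rw [sub_eq_zero] at h
      have h2 : ‖w‖ ≤ 1 := by simpa using hw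
      rw [h, norm_inv] at h2
      have := one_lt_inv₀ (norm_pos_iff.mpr h0) |>.mpr h1
      linarith
    apply Complex.circleIntegral_sub_inv_smul_of_differentiable_on_off_countable
      Set.countable_empty (by simpa using h1)
    · exact ContinuousOn.inv₀ (by fun_prop) hne
    · intro w hw
      exact DifferentiableAt.inv (by fun_prop) (hne w (Metric.ball_subset_closedBall hw.1))
  have hcircle : ∮ w in C(0, 1), (w - ζ)⁻¹ • (w - ζ⁻¹)⁻¹ =
      ∫ θ in (0 : ℝ)..2 * Real.pi, Complex.I * f θ := by
    rw [circleIntegral]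
    congr 1
    funext θ
    have he : circleMap 0 1 θ ≠ 0 := circleMap_ne_center one_ne_zero
    have hcos : ((2 * Real.cos θ : ℝ) : ℂ) = circleMap 0 1 θ + (circleMap 0 1 θ)⁻¹ := by
      rw [Complex.ofReal_mul, Complex.ofReal_cos]
      simp only [circleMap, Complex.cos, Complex.ofReal_one, one_mul, zero_add, ← Complex.exp_neg]
      push_cast
      rw [neg_mul]
      ring
    have hfac : (circleMap 0 1 θ - ζ) * (circleMap 0 1 θ - ζ⁻¹) =
        circleMap 0 1 θ * (((2 * Real.cos θ : ℝ) : ℂ) - z) := by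
      rw [hcos, hsum]
      field_simp
      ring
    simp only [deriv_circleMap, smul_eq_mul, hf]
    rw [← mul_inv, hfac, mul_inv]
    field_simp
  have hrefl : ∫ θ in Real.pi..2 * Real.pi, f θ = ∫ θ in (0 : ℝ)..Real.pi, f θ := by
    have h := intervalIntegral.integral_comp_sub_left f (2 * Real.pi) (a := 0) (b := Real.pi)
    rw [sub_zero, two_mul, add_sub_cancel_right, ← two_mul] at h
    rw [← h]
    congr 1
    funext θ
    simp only [hf, Real.cos_two_pi_sub]
  have hsplit := intervalIntegral.integral_add_adjacent_intervals
    (hcont.intervalIntegrable 0 Real.pi) (hcont.intervalIntegrable Real.pi (2 * Real.pi))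
    (μ := MeasureTheory.volume)
  rw [hrefl] at hsplit
  rw [hcircle, intervalIntegral.integral_const_mul, ← hsplit, smul_eq_mul] at hI
  have hI2 := Complex.I_ne_zero
  apply mul_left_cancel₀ (mul_ne_zero two_ne_zero hI2)
  linear_combination hI

theorem msc_eq_neg {z ζ : ℂ} (hz : z.im ≠ 0) (h0 : ζ ≠ 0) (h1 : ‖ζ‖ < 1)
    (hsum : z = ζ + ζ⁻¹) : msc z = -ζ := by
  set g : ℝ → ℂ := fun x => (rhoSc x : ℂ) / ((x : ℂ) - z) with hg
  have hgc : Continuous g := by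
    refine Continuous.div ?_ (by fun_prop) (ofReal_sub_ne_zero hz)
    unfold rhoSc
    fun_prop
  have hsub := intervalIntegral.integral_deriv_smul_comp (a := Real.pi) (b := 0)
    (f := fun θ => 2 * Real.cos θ) (f' := fun θ => 2 * -Real.sin θ) (g := g)
    (fun θ _ => (Real.hasDerivAt_cos θ).const_mul 2) (by fun_prop) hgc
  have hfun : ∀ θ ∈ Set.uIcc Real.pi 0,
      (2 * -Real.sin θ) • (g ∘ fun θ => 2 * Real.cos θ) θ =
        (2 * Real.pi : ℂ)⁻¹ * ((((2 * Real.cos θ : ℝ) : ℂ) + z) -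
          (4 - z ^ 2) * (((2 * Real.cos θ : ℝ) : ℂ) - z)⁻¹) := by
    intro θ hθ
    rw [Set.uIcc_of_ge Real.pi_pos.le] at hθ
    have hs : Real.sqrt (4 - (2 * Real.cos θ) ^ 2) = 2 * Real.sin θ := by
      rw [← Real.sqrt_sq (mul_nonneg zero_le_two (Real.sin_nonneg_of_mem_Icc hθ))]
      congr 1
      linear_combination (-4 : ℝ) * Real.sin_sq_add_cos_sq θ
    have hd := ofReal_sub_ne_zero hz (2 * Real.cos θ)
    have hpi : (Real.pi : ℂ) ≠ 0 := by exact_mod_cast Real.pi_ne_zero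
    simp only [Function.comp, hg, rhoSc, hs, Complex.real_smul]
    have hsc : ((2 * Real.sin θ : ℝ) : ℂ) ^ 2 = 4 - ((2 * Real.cos θ : ℝ) : ℂ) ^ 2 := by
      norm_cast
      linear_combination (4 : ℝ) * Real.sin_sq_add_cos_sq θ
    rw [mul_neg, Complex.ofReal_neg, Complex.ofReal_div, Complex.ofReal_mul 2 Real.pi]
    generalize ((2 * Real.sin θ : ℝ) : ℂ) = s at *
    generalize ((2 * Real.cos θ : ℝ) : ℂ) = c at *
    push_cast
    field_simp
    linear_combination -hsc
  rw [intervalIntegral.integral_congr hfun, intervalIntegral.integral_symm,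
    intervalIntegral.integral_const_mul] at hsub
  have hcinv : Continuous fun θ : ℝ => (((2 * Real.cos θ : ℝ) : ℂ) - z)⁻¹ :=
    Continuous.inv₀ (by fun_prop) fun θ => ofReal_sub_ne_zero hz _
  rw [intervalIntegral.integral_sub (Continuous.intervalIntegrable (by fun_prop) _ _)
    (Continuous.intervalIntegrable (by fun_prop) _ _),
    intervalIntegral.integral_const_mul, integral_inv_two_cos_sub hz h0 h1 hsum,
    intervalIntegral.integral_add (Continuous.intervalIntegrable (by fun_prop) _ _)
    (Continuous.intervalIntegrable (by fun_prop) _ _), intervalIntegral.integral_ofReal,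
    intervalIntegral.integral_const_mul, integral_cos] at hsub
  have hpi : (Real.pi : ℂ) ≠ 0 := by exact_mod_cast Real.pi_ne_zero
  have hdiff : ζ - ζ⁻¹ ≠ 0 := by
    intro h
    rw [sub_eq_zero] at h
    have h2 : ‖ζ‖ = ‖ζ‖⁻¹ := by rw [← norm_inv, ← h]
    have := one_lt_inv₀ (norm_pos_iff.mpr h0) |>.mpr h1
    linarith
  have h4 : 4 - z ^ 2 = -(ζ - ζ⁻¹) ^ 2 := by
    rw [hsum]
    field_simp
    ring
  simp only [Real.cos_pi, Real.cos_zero, mul_one, mul_neg] at hsub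
  rw [msc, ← hsub, h4]
  simp only [Real.sin_pi, Real.sin_zero, sub_zero, mul_zero, Complex.ofReal_zero, zero_add,
    intervalIntegral.integral_const, Complex.real_smul]
  have hcancel : -(ζ - ζ⁻¹) ^ 2 * (Real.pi * (ζ - ζ⁻¹)⁻¹) = -Real.pi * (ζ - ζ⁻¹) := by
    field_simp
  rw [hcancel, hsum]
  field_simp
  ring

theorem msc_quadratic {z : ℂ} (hz : z.im ≠ 0) : msc z ^ 2 + z * msc z + 1 = 0 := by
  obtain ⟨ζ, h0, h1, hsum⟩ := exists_joukowski hz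
  rw [msc_eq_neg hz h0 h1 hsum, hsum]
  field_simp
  ring

theorem norm_msc_lt_one {z : ℂ} (hz : z.im ≠ 0) : ‖msc z‖ < 1 := by
  obtain ⟨ζ, h0, h1, hsum⟩ := exists_joukowski hz
  rwa [msc_eq_neg hz h0 h1 hsum, norm_neg]

theorem one_sub_mul_ne_zero {a b : ℂ} (ha : ‖a‖ < 1) (hb : ‖b‖ < 1) : 1 - a * b ≠ 0 := by
  intro h
  have h1 : ‖a * b‖ = 1 := by rw [← sub_eq_zero.mp h, norm_one]
  rw [norm_mul] at h1
  nlinarith [norm_nonneg a, norm_nonneg b]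

theorem one_sub_msc_mul_ne_zero {a b : ℂ} (ha : a.im ≠ 0) (hb : b.im ≠ 0) :
    1 - msc a * msc b ≠ 0 :=
  one_sub_mul_ne_zero (norm_msc_lt_one ha) (norm_msc_lt_one hb)

theorem sub_mul_msc_mul_msc {a b : ℂ} (ha : a.im ≠ 0) (hb : b.im ≠ 0) :
    (a - b) * (msc a * msc b) = (msc a - msc b) * (1 - msc a * msc b) := by
  linear_combination msc b * msc_quadratic ha - msc a * msc_quadratic hb

theorem continuousAt_msc {w : ℂ} (hw : w.im ≠ 0) : ContinuousAt msc w := by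
  have hopen : ∀ᶠ z in nhds w, z.im ≠ 0 :=
    Complex.continuous_im.continuousAt.eventually_ne hw
  have hpos : 0 < 1 - ‖msc w‖ := by linarith [norm_msc_lt_one hw]
  have hbound : ∀ᶠ z in nhds w, ‖msc z - msc w‖ ≤ ‖z - w‖ / (1 - ‖msc w‖) := by
    filter_upwards [hopen] with z hz
    rw [le_div_iff₀ hpos]
    have h := congrArg norm (sub_mul_msc_mul_msc hz hw)
    rw [norm_mul, norm_mul, norm_mul] at h
    have hz1 := norm_msc_lt_one hz
    have hw1 := norm_msc_lt_one hw
    have h2 : 1 - ‖msc w‖ ≤ ‖1 - msc z * msc w‖ := by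
      have := norm_sub_norm_le (1 : ℂ) (msc z * msc w)
      rw [norm_one, norm_mul] at this
      nlinarith [norm_nonneg (msc z), norm_nonneg (msc w)]
    have h3 : ‖msc z‖ * ‖msc w‖ ≤ 1 := by nlinarith [norm_nonneg (msc z), norm_nonneg (msc w)]
    calc ‖msc z - msc w‖ * (1 - ‖msc w‖) ≤ ‖msc z - msc w‖ * ‖1 - msc z * msc w‖ := by gcongr
      _ = ‖z - w‖ * (‖msc z‖ * ‖msc w‖) := h.symm
      _ ≤ ‖z - w‖ := mul_le_of_le_one_right (norm_nonneg _) h3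
  rw [ContinuousAt, tendsto_iff_norm_sub_tendsto_zero]
  refine squeeze_zero' (Filter.Eventually.of_forall fun _ => norm_nonneg _) hbound ?_
  have : Continuous fun z : ℂ => ‖z - w‖ / (1 - ‖msc w‖) := by fun_prop
  simpa using this.tendsto w

/-- The chords `ab` and `cd` of the disk cross in their interiors. -/
def Crosses {k : ℕ} (a b c d : Fin k) : Prop :=
  (((a < c ∧ c < b) ∨ (b < c ∧ c < a)) ∧ ((d < a ∧ d < b) ∨ (a < d ∧ b < d))) ∨
    (((a < d ∧ d < b) ∨ (b < d ∧ d < a)) ∧ ((c < a ∧ c < b) ∨ (a < c ∧ b < c)))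

/-- A set of edges is non-crossing. -/
def NonCross {k : ℕ} (E : Finset (Sym2 (Fin k))) : Prop :=
  ∀ a b c d, s(a, b) ∈ E → s(c, d) ∈ E → ¬ Crosses a b c d

/-- The edges of the complete graph on `S`. -/
def edgesOn {k : ℕ} (S : Finset (Fin k)) : Finset (Sym2 (Fin k)) :=
  S.sym2.filter fun e => ¬ e.IsDiag

/-- The edges joining `p` to the elements of `A`. -/
def starEdges {k : ℕ} (p : Fin k) (A : Finset (Fin k)) : Finset (Sym2 (Fin k)) :=
  A.image fun x => s(p, x)

open scoped Classical in
/-- The weighted sum over non-crossing graphs on `S`. -/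
noncomputable def ncSum {k : ℕ} (S : Finset (Fin k)) (w : Sym2 (Fin k) → ℂ) : ℂ :=
  ∑ E ∈ (edgesOn S).powerset, if NonCross E then ∏ e ∈ E, w e else 0

section Combinatorics

variable {k : ℕ}

theorem mk_mem_edgesOn {S : Finset (Fin k)} {a b : Fin k} :
    s(a, b) ∈ edgesOn S ↔ a ∈ S ∧ b ∈ S ∧ a ≠ b := by
  simp [edgesOn, and_assoc]

theorem mk_mem_starEdges {p : Fin k} {A : Finset (Fin k)} {a b : Fin k} :
    s(a, b) ∈ starEdges p A ↔ (a = p ∧ b ∈ A) ∨ (b = p ∧ a ∈ A) := by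
  simp only [starEdges, Finset.mem_image, Sym2.eq_iff]
  constructor
  · rintro ⟨x, hx, ⟨rfl, rfl⟩ | ⟨rfl, rfl⟩⟩ <;> simp [hx]
  · rintro (⟨rfl, h⟩ | ⟨rfl, h⟩)
    · exact ⟨b, h, by simp⟩
    · exact ⟨a, h, by simp⟩

theorem mk_self_mem_starEdges {p x : Fin k} {A : Finset (Fin k)} (hx : x ∈ A) :
    s(p, x) ∈ starEdges p A :=
  Finset.mem_image_of_mem _ hx

theorem prod_starEdges (p : Fin k) (A : Finset (Fin k)) (w : Sym2 (Fin k) → ℂ) :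
    ∏ e ∈ starEdges p A, w e = ∏ x ∈ A, w s(p, x) := by
  rw [starEdges, Finset.prod_image]
  exact fun x _ y _ h => Sym2.congr_right.mp h

theorem Crosses.symm {a b c d : Fin k} (h : Crosses a b c d) : Crosses c d a b := by
  simp only [Crosses, Fin.lt_def] at *; omega

theorem Crosses.swap_left {a b c d : Fin k} (h : Crosses a b c d) : Crosses b a c d := by
  simp only [Crosses, Fin.lt_def] at *; omega

theorem Crosses.swap_right {a b c d : Fin k} (h : Crosses a b c d) : Crosses a b d c := by
  simp only [Crosses, Fin.lt_def] at *; omega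

theorem not_crosses_of_common (p x y : Fin k) : ¬ Crosses p x p y := by
  simp only [Crosses, Fin.lt_def]; omega

theorem nonCross_iff {E : Finset (Sym2 (Fin k))} :
    NonCross E ↔ ∀ a b c d : Fin k, a < c → c < b → b < d → s(a, b) ∈ E → s(c, d) ∈ E → False := by
  constructor
  · intro h a b c d h1 h2 h3 hab hcd
    refine h a b c d hab hcd ?_
    simp only [Crosses, Fin.lt_def] at *; omega
  · intro h a b c d hab hcd hs
    have hba := hab
    have hdc := hcd
    rw [Sym2.eq_swap] at hba hdc
    rcases hs with ⟨⟨h1, h2⟩ | ⟨h1, h2⟩, ⟨h3, h4⟩ | ⟨h3, h4⟩⟩ |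
      ⟨⟨h1, h2⟩ | ⟨h1, h2⟩, ⟨h3, h4⟩ | ⟨h3, h4⟩⟩
    · exact h d c a b h3 h1 h2 hdc hab
    · exact h a b c d h1 h2 h4 hab hcd
    · exact h d c b a h4 h1 h2 hdc hba
    · exact h b a c d h1 h2 h3 hba hcd
    · exact h c d a b h3 h1 h2 hcd hab
    · exact h a b d c h1 h2 h4 hab hdc
    · exact h c d b a h4 h1 h2 hcd hba
    · exact h b a d c h1 h2 h3 hba hdc

theorem NonCross.mono {E F : Finset (Sym2 (Fin k))} (h : NonCross F) (hEF : E ⊆ F) : NonCross E :=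
  fun a b c d hab hcd => h a b c d (hEF hab) (hEF hcd)

theorem nonCross_union_starEdges {H : Finset (Sym2 (Fin k))} {p : Fin k} {A : Finset (Fin k)} :
    NonCross (H ∪ starEdges p A) ↔
      NonCross H ∧ ∀ x ∈ A, ∀ c d, s(c, d) ∈ H → ¬ Crosses p x c d := by
  constructor
  · intro h
    exact ⟨h.mono Finset.subset_union_left, fun x hx c d hcd =>
      h p x c d (Finset.mem_union_right _ (mk_self_mem_starEdges hx)) (Finset.mem_union_left _ hcd)⟩
  · rintro ⟨hH, hA⟩ a b c d hab hcd hs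
    rw [Finset.mem_union, mk_mem_starEdges] at hab hcd
    rcases hab with hab | ⟨rfl, hb⟩ | ⟨rfl, ha⟩
    · rcases hcd with hcd | ⟨rfl, hd⟩ | ⟨rfl, hc⟩
      · exact hH a b c d hab hcd hs
      · exact hA d hd a b hab hs.symm
      · exact hA c hc a b hab hs.symm.swap_left
    · rcases hcd with hcd | ⟨rfl, hd⟩ | ⟨rfl, hc⟩
      · exact hA b hb c d hcd hs
      · exact not_crosses_of_common _ _ _ hs
      · exact not_crosses_of_common _ _ _ hs.swap_right
    · rcases hcd with hcd | ⟨rfl, hd⟩ | ⟨rfl, hc⟩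
      · exact hA a ha c d hcd hs.swap_left
      · exact not_crosses_of_common _ _ _ hs.swap_left
      · exact not_crosses_of_common _ _ _ hs.swap_left.swap_right

theorem disjoint_starEdges {p : Fin k} {R A : Finset (Fin k)} (hp : p ∉ R)
    {H : Finset (Sym2 (Fin k))} (hH : H ⊆ edgesOn R) : Disjoint H (starEdges p A) := by
  rw [Finset.disjoint_left]
  intro e he hs
  obtain ⟨x, -, rfl⟩ := Finset.mem_image.mp hs
  exact hp (mk_mem_edgesOn.mp (hH he)).1

theorem edgesOn_mono {S T : Finset (Fin k)} (h : S ⊆ T) : edgesOn S ⊆ edgesOn T := by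
  intro e
  induction e with
  | _ a b =>
    rw [mk_mem_edgesOn, mk_mem_edgesOn]
    exact fun ⟨ha, hb, hab⟩ => ⟨h ha, h hb, hab⟩

theorem starEdges_subset_edgesOn {p : Fin k} {R A : Finset (Fin k)} (hp : p ∉ R) (hA : A ⊆ R) :
    starEdges p A ⊆ edgesOn (insert p R) := by
  intro e he
  obtain ⟨x, hx, rfl⟩ := Finset.mem_image.mp he
  exact mk_mem_edgesOn.mpr ⟨Finset.mem_insert_self _ _, Finset.mem_insert_of_mem (hA hx),
    fun h => hp (h ▸ hA hx)⟩

/-- A graph on `insert p R` is a graph on `R` together with a set of neighbours of `p`. -/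
theorem sum_powerset_edgesOn_insert {p : Fin k} {R : Finset (Fin k)} (hp : p ∉ R)
    (f : Finset (Sym2 (Fin k)) → ℂ) :
    ∑ E ∈ (edgesOn (insert p R)).powerset, f E =
      ∑ H ∈ (edgesOn R).powerset, ∑ A ∈ R.powerset, f (H ∪ starEdges p A) := by
  have hdecomp : ∀ E ⊆ edgesOn (insert p R),
      E ∩ edgesOn R ∪ starEdges p (R.filter fun x => s(p, x) ∈ E) = E := by
    intro E hE
    ext e
    induction e with
    | _ a b =>
      simp only [Finset.mem_union, Finset.mem_inter, mk_mem_starEdges, mk_mem_edgesOn,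
        Finset.mem_filter]
      constructor
      · rintro (h | ⟨rfl, h⟩ | ⟨rfl, h⟩)
        · exact h.1
        · exact h.2
        · rw [Sym2.eq_swap]; exact h.2
      · intro he
        have h := mk_mem_edgesOn.mp (hE he)
        simp only [Finset.mem_insert] at h
        obtain ⟨rfl | ha, rfl | hb, hab⟩ := h
        · exact absurd rfl hab
        · exact Or.inr (Or.inl ⟨rfl, hb, he⟩)
        · exact Or.inr (Or.inr ⟨rfl, ha, Sym2.eq_swap ▸ he⟩)
        · exact Or.inl ⟨he, ha, hb, hab⟩
  rw [← Finset.sum_product']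
  refine Finset.sum_nbij' (fun E => (E ∩ edgesOn R, R.filter fun x => s(p, x) ∈ E))
    (fun x => x.1 ∪ starEdges p x.2) ?_ ?_ ?_ ?_ ?_
  · intro E _
    simp [Finset.inter_subset_right, Finset.filter_subset]
  · rintro ⟨H, A⟩ h
    simp only [Finset.mem_product, Finset.mem_powerset] at h ⊢
    exact Finset.union_subset (h.1.trans (edgesOn_mono (Finset.subset_insert _ _)))
      (starEdges_subset_edgesOn hp h.2)
  · intro E hE
    exact hdecomp E (Finset.mem_powerset.mp hE)
  · rintro ⟨H, A⟩ h
    simp only [Finset.mem_product, Finset.mem_powerset] at h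
    obtain ⟨hH, hA⟩ := h
    refine Prod.ext ?_ ?_
    · ext e
      induction e with
      | _ a b =>
        simp only [Finset.mem_inter, Finset.mem_union, mk_mem_starEdges]
        constructor
        · rintro ⟨h | ⟨rfl, h⟩ | ⟨rfl, h⟩, hR⟩
          · exact h
          · exact absurd (mk_mem_edgesOn.mp hR).1 hp
          · exact absurd (mk_mem_edgesOn.mp hR).2.1 hp
        · exact fun h => ⟨Or.inl h, hH h⟩
    · ext x
      simp only [Finset.mem_filter, Finset.mem_union]
      constructor
      · rintro ⟨hx, h | h⟩
        · exact absurd (mk_mem_edgesOn.mp (hH h)).1 hp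
        · rcases mk_mem_starEdges.mp h with h | h
          · exact h.2
          · exact absurd (h.1 ▸ hx) hp
      · exact fun h => ⟨hA h, Or.inr (mk_self_mem_starEdges h)⟩
  · intro E hE
    rw [hdecomp E (Finset.mem_powerset.mp hE)]

open scoped Classical in
/-- The vertices of `R` that `p` can be joined to without crossing an edge of `H`. -/
noncomputable def visible (p : Fin k) (R : Finset (Fin k)) (H : Finset (Sym2 (Fin k))) :
    Finset (Fin k) :=
  R.filter fun x => ∀ c d, s(c, d) ∈ H → ¬ Crosses p x c d

open scoped Classical in
theorem sum_powerset_visible (p : Fin k) (R : Finset (Fin k)) (H : Finset (Sym2 (Fin k)))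
    (f : Finset (Fin k) → ℂ) :
    ∑ A ∈ R.powerset, (if ∀ x ∈ A, ∀ c d, s(c, d) ∈ H → ¬ Crosses p x c d then f A else 0) =
      ∑ A ∈ (visible p R H).powerset, f A := by
  rw [← Finset.sum_filter]
  congr 1
  ext A
  simp only [visible, Finset.mem_filter, Finset.mem_powerset, Finset.subset_iff]
  exact ⟨fun h x hx => ⟨h.1 hx, h.2 x hx⟩, fun h => ⟨fun x hx => (h hx).1, fun x hx => (h hx).2⟩⟩

open scoped Classical in
theorem ncSum_insert {p : Fin k} {R : Finset (Fin k)} (hp : p ∉ R) (w : Sym2 (Fin k) → ℂ) :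
    ncSum (insert p R) w = ∑ H ∈ (edgesOn R).powerset,
      if NonCross H then (∏ e ∈ H, w e) * ∏ x ∈ visible p R H, (1 + w s(p, x)) else 0 := by
  rw [ncSum, sum_powerset_edgesOn_insert hp]
  refine Finset.sum_congr rfl fun H hH => ?_
  rw [Finset.mem_powerset] at hH
  split_ifs with hN
  · rw [Finset.prod_one_add, ← sum_powerset_visible, Finset.mul_sum]
    refine Finset.sum_congr rfl fun A _ => ?_
    simp only [nonCross_union_starEdges, hN, true_and]
    split_ifs
    · rw [Finset.prod_union (disjoint_starEdges hp hH), prod_starEdges]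
    · simp
  · exact Finset.sum_eq_zero fun A _ => if_neg fun h => hN (nonCross_union_starEdges.mp h).1

open scoped Classical in
/-- The sum over the ways of distributing neighbours in `V` between two adjacent vertices without
creating crossings, where `κ` records the cyclic order. -/
noncomputable def splitSum {ι : Type*} (κ : ι → ℕ) (u v : ι → ℂ) (V : Finset ι) : ℂ :=
  ∑ B ∈ V.powerset, ∑ A ∈ V.powerset,
    if ∀ x ∈ A, ∀ y ∈ B, κ y ≤ κ x then (∏ y ∈ B, u y) * ∏ x ∈ A, v x else 0

open scoped Classical in
theorem splitSum_insert {ι : Type*} {κ : ι → ℕ} (u v : ι → ℂ) {a : ι}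
    {V : Finset ι} (ha : a ∉ V) (hmax : ∀ x ∈ V, κ x < κ a) :
    splitSum κ u v (insert a V) =
      (1 + v a) * (splitSum κ u v V + u a * ∏ y ∈ V, (1 + u y)) := by
  have hnot : ∀ {A : Finset ι}, A ∈ V.powerset → a ∉ A := fun hA h =>
    ha (Finset.mem_powerset.mp hA h)
  have hc1 : ∀ A B : Finset ι, B ∈ V.powerset →
      ((∀ x ∈ insert a A, ∀ y ∈ B, κ y ≤ κ x) ↔ ∀ x ∈ A, ∀ y ∈ B, κ y ≤ κ x) := by
    intro A B hB
    rw [Finset.forall_mem_insert, and_iff_right]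
    exact fun y hy => (hmax y (Finset.mem_powerset.mp hB hy)).le
  have hc2 : ∀ A B : Finset ι, A ∈ V.powerset → B ∈ V.powerset →
      ((∀ x ∈ A, ∀ y ∈ insert a B, κ y ≤ κ x) ↔ A = ∅) := by
    intro A B hA _
    constructor
    · intro h
      refine Finset.eq_empty_of_forall_notMem fun x hx => ?_
      exact absurd (h x hx a (Finset.mem_insert_self _ _))
        (not_le.mpr (hmax x (Finset.mem_powerset.mp hA hx)))
    · rintro rfl
      simp
  have hc3 : ∀ A B : Finset ι, A ∈ V.powerset → B ∈ V.powerset →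
      ((∀ x ∈ insert a A, ∀ y ∈ insert a B, κ y ≤ κ x) ↔ A = ∅) := by
    intro A B hA hB
    rw [Finset.forall_mem_insert, hc2 A B hA hB, and_iff_right]
    rw [Finset.forall_mem_insert]
    exact ⟨le_rfl, fun y hy => (hmax y (Finset.mem_powerset.mp hB hy)).le⟩
  have h1 : ∑ B ∈ V.powerset, ∑ A ∈ V.powerset,
      (if ∀ x ∈ insert a A, ∀ y ∈ B, κ y ≤ κ x then
        (∏ y ∈ B, u y) * ∏ x ∈ insert a A, v x else 0) = v a * splitSum κ u v V := by
    rw [splitSum, Finset.mul_sum]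
    refine Finset.sum_congr rfl fun B hB => ?_
    rw [Finset.mul_sum]
    refine Finset.sum_congr rfl fun A hA => ?_
    simp only [hc1 A B hB, Finset.prod_insert (hnot hA), mul_ite, mul_zero]
    congr 1
    ring
  have h2 : ∑ B ∈ V.powerset, ∑ A ∈ V.powerset,
      (if ∀ x ∈ A, ∀ y ∈ insert a B, κ y ≤ κ x then
        (∏ y ∈ insert a B, u y) * ∏ x ∈ A, v x else 0) = u a * ∏ y ∈ V, (1 + u y) := by
    rw [Finset.prod_one_add, Finset.mul_sum]
    refine Finset.sum_congr rfl fun B hB => ?_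
    rw [Finset.sum_eq_single_of_mem ∅ (Finset.empty_mem_powerset V)]
    · simp [Finset.prod_insert (hnot hB)]
    · intro A hA hne
      rw [if_neg (by rwa [hc2 A B hA hB])]
  have h3 : ∑ B ∈ V.powerset, ∑ A ∈ V.powerset,
      (if ∀ x ∈ insert a A, ∀ y ∈ insert a B, κ y ≤ κ x then
        (∏ y ∈ insert a B, u y) * ∏ x ∈ insert a A, v x else 0) =
      v a * (u a * ∏ y ∈ V, (1 + u y)) := by
    rw [Finset.prod_one_add, Finset.mul_sum, Finset.mul_sum]
    refine Finset.sum_congr rfl fun B hB => ?_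
    rw [Finset.sum_eq_single_of_mem ∅ (Finset.empty_mem_powerset V)]
    · rw [if_pos ((hc3 ∅ B (Finset.empty_mem_powerset V) hB).mpr rfl)]
      simp [Finset.prod_insert (hnot hB)]
      ring
    · intro A hA hne
      rw [if_neg (by rwa [hc3 A B hA hB])]
  rw [splitSum, Finset.sum_powerset_insert ha]
  simp_rw [Finset.sum_powerset_insert ha, Finset.sum_add_distrib]
  rw [h1, h2, h3, ← splitSum]
  ring

theorem splitSum_eq {ι : Type*} {κ : ι → ℕ} (hκ : Function.Injective κ) (a b : ℂ) (n : ι → ℂ)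
    (V : Finset ι) (ha : ∀ x ∈ V, 1 - a * n x ≠ 0) (hb : ∀ x ∈ V, 1 - b * n x ≠ 0) :
    (a - b) * splitSum κ (fun x => b * n x / (1 - b * n x)) (fun x => a * n x / (1 - a * n x)) V =
      a * ∏ x ∈ V, (1 + a * n x / (1 - a * n x)) - b * ∏ x ∈ V, (1 + b * n x / (1 - b * n x)) := by
  classical
  revert ha hb
  refine Finset.induction_on_max_value κ V ?_ ?_
  · simp [splitSum]
  · intro c V hc hmax ih ha hb
    have ih := ih (fun x hx => ha x (Finset.mem_insert_of_mem hx))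
      (fun x hx => hb x (Finset.mem_insert_of_mem hx))
    have hac := ha c (Finset.mem_insert_self _ _)
    have hbc := hb c (Finset.mem_insert_self _ _)
    rw [splitSum_insert _ _ hc, Finset.prod_insert hc, Finset.prod_insert hc, mul_left_comm,
      mul_add, ih]
    · generalize ∏ x ∈ V, (1 + b * n x / (1 - b * n x)) = P
      generalize ∏ x ∈ V, (1 + a * n x / (1 - a * n x)) = Q
      have hx := mul_inv_cancel₀ hac
      have hy := mul_inv_cancel₀ hbc
      simp only [div_eq_mul_inv]
      generalize (1 - a * n c)⁻¹ = x at *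
      generalize (1 - b * n c)⁻¹ = y at *
      have hx1 : 1 + a * n c * x = x := by linear_combination -hx
      have hy1 : 1 + b * n c * y = y := by linear_combination -hy
      rw [hx1, hy1]
      linear_combination b * P * (x * hy - y * hx)
    · intro x hx
      exact lt_of_le_of_ne (hmax x hx) fun h => hc (hκ h ▸ hx)

/-- The position of `x` in the cyclic order starting just after `p`. -/
def cyclicPos (p x : Fin k) : ℕ := if p < x then x else x + k

theorem cyclicPos_injective (p : Fin k) : Function.Injective (cyclicPos p) := by
  intro x y h
  simp only [cyclicPos, Fin.lt_def] at h
  apply Fin.ext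
  split_ifs at h <;> omega

theorem crosses_iff_of_adjacent {p p' x c d : Fin k} (hlt : p < p')
    (hc : c < p ∨ p' < c) (hd : d < p ∨ p' < d) : Crosses p' x c d ↔ Crosses p x c d := by
  simp only [Crosses, Fin.lt_def] at *; omega

theorem not_crosses_of_adjacent {p p' c d : Fin k} (hlt : p < p')
    (hc : c < p ∨ p' < c) (hd : d < p ∨ p' < d) : ¬ Crosses p p' c d := by
  simp only [Crosses, Fin.lt_def] at *; omega

theorem not_crosses_iff_cyclicPos_le {p p' x y : Fin k} (hlt : p < p') (hx : x < p ∨ p' < x)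
    (hy : y < p ∨ p' < y) : ¬ Crosses p x p' y ↔ cyclicPos p y ≤ cyclicPos p x := by
  simp only [Crosses, cyclicPos, Fin.lt_def] at *
  split_ifs <;> omega

section Adjacent

variable {p p' : Fin k} {R : Finset (Fin k)}

theorem visible_eq_of_adjacent (hlt : p < p') (hgap : ∀ x ∈ R, x < p ∨ p' < x)
    {H : Finset (Sym2 (Fin k))} (hH : H ⊆ edgesOn R) :
    visible p' R H = visible p R H := by
  classical
  refine Finset.filter_congr fun x hx => ?_
  refine forall₂_congr fun c d => ?_
  refine imp_congr_right fun hcd => ?_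
  have h := mk_mem_edgesOn.mp (hH hcd)
  rw [crosses_iff_of_adjacent hlt (hgap c h.1) (hgap d h.2.1)]

theorem nonCross_two_starEdges (hlt : p < p') (hgap : ∀ x ∈ R, x < p ∨ p' < x)
    {H : Finset (Sym2 (Fin k))} (hH : H ⊆ edgesOn R)
    {A B : Finset (Fin k)} (hA : A ⊆ R) (hB : B ⊆ R) :
    NonCross (H ∪ starEdges p' B ∪ starEdges p A) ↔
      NonCross H ∧ (∀ y ∈ B, ∀ c d, s(c, d) ∈ H → ¬ Crosses p y c d) ∧
        (∀ x ∈ A, ∀ c d, s(c, d) ∈ H → ¬ Crosses p x c d) ∧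
          ∀ x ∈ A, ∀ y ∈ B, cyclicPos p y ≤ cyclicPos p x := by
  rw [nonCross_union_starEdges, nonCross_union_starEdges, and_assoc]
  refine and_congr_right fun _ => and_congr ?_ ?_
  · refine forall₂_congr fun y hy => forall₂_congr fun c d => imp_congr_right fun hcd => ?_
    have h := mk_mem_edgesOn.mp (hH hcd)
    rw [crosses_iff_of_adjacent hlt (hgap c h.1) (hgap d h.2.1)]
  · constructor
    · intro h
      refine ⟨fun x hx c d hcd => h x hx c d (Finset.mem_union_left _ hcd), fun x hx y hy => ?_⟩
      rw [← not_crosses_iff_cyclicPos_le hlt (hgap x (hA hx)) (hgap y (hB hy))]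
      exact h x hx p' y (Finset.mem_union_right _ (mk_self_mem_starEdges hy))
    · rintro ⟨h1, h2⟩ x hx c d hcd
      rcases Finset.mem_union.mp hcd with hcd | hcd
      · exact h1 x hx c d hcd
      · rcases mk_mem_starEdges.mp hcd with ⟨rfl, hd⟩ | ⟨rfl, hc⟩
        · exact (not_crosses_iff_cyclicPos_le hlt (hgap x (hA hx)) (hgap d (hB hd))).mpr
            (h2 x hx d hd)
        · exact fun hs => (not_crosses_iff_cyclicPos_le hlt (hgap x (hA hx)) (hgap c (hB hc))).mpr
            (h2 x hx c hc) hs.swap_right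

theorem nonCross_insert_adjacent_edge (hlt : p < p') (hgap : ∀ x ∈ R, x < p ∨ p' < x)
    {H : Finset (Sym2 (Fin k))} (hH : H ⊆ edgesOn R)
    {A B : Finset (Fin k)} :
    NonCross (H ∪ starEdges p' B ∪ starEdges p (insert p' A)) ↔
      NonCross (H ∪ starEdges p' B ∪ starEdges p A) := by
  rw [nonCross_union_starEdges, nonCross_union_starEdges (A := A), Finset.forall_mem_insert]
  refine and_congr_right fun _ => and_iff_right fun c d hcd => ?_
  rcases Finset.mem_union.mp hcd with hcd | hcd
  · have h := mk_mem_edgesOn.mp (hH hcd)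
    exact not_crosses_of_adjacent hlt (hgap c h.1) (hgap d h.2.1)
  · rcases mk_mem_starEdges.mp hcd with ⟨rfl, hd⟩ | ⟨rfl, hc⟩
    · exact fun hs => not_crosses_of_common _ _ _ hs.swap_left
    · exact fun hs => not_crosses_of_common _ _ _ hs.swap_left.swap_right

open scoped Classical in
theorem ncSum_insert_insert (hlt : p < p') (hgap : ∀ x ∈ R, x < p ∨ p' < x)
    (w : Sym2 (Fin k) → ℂ) :
    ncSum (insert p (insert p' R)) w = (1 + w s(p, p')) * ∑ H ∈ (edgesOn R).powerset,
      if NonCross H then (∏ e ∈ H, w e) *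
        splitSum (cyclicPos p) (fun x => w s(p', x)) (fun x => w s(p, x)) (visible p R H)
      else 0 := by
  have hp'R : p' ∉ R := fun h => by
    rcases hgap _ h with h | h
    · exact absurd h hlt.le.not_gt
    · exact lt_irrefl _ h
  have hpR : p ∉ R := fun h => by
    rcases hgap _ h with h | h
    · exact lt_irrefl _ h
    · exact absurd h hlt.le.not_gt
  have hp : p ∉ insert p' R := by
    rw [Finset.mem_insert, not_or]
    exact ⟨hlt.ne, hpR⟩
  rw [ncSum, sum_powerset_edgesOn_insert hp,
    sum_powerset_edgesOn_insert hp'R (fun E => ∑ A ∈ (insert p' R).powerset,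
      if NonCross (E ∪ starEdges p A) then ∏ e ∈ E ∪ starEdges p A, w e else 0), Finset.mul_sum]
  refine Finset.sum_congr rfl fun H hH => ?_
  rw [Finset.mem_powerset] at hH
  have hterm : ∀ B ∈ R.powerset, ∑ A ∈ (insert p' R).powerset,
      (if NonCross (H ∪ starEdges p' B ∪ starEdges p A) then
        ∏ e ∈ H ∪ starEdges p' B ∪ starEdges p A, w e else 0) =
      ∑ A ∈ R.powerset, if NonCross (H ∪ starEdges p' B ∪ starEdges p A) then
        (1 + w s(p, p')) *
          ((∏ e ∈ H, w e) * ((∏ y ∈ B, w s(p', y)) * ∏ x ∈ A, w s(p, x))) else 0 := by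
    intro B hB
    rw [Finset.mem_powerset] at hB
    rw [Finset.sum_powerset_insert hp'R, ← Finset.sum_add_distrib]
    refine Finset.sum_congr rfl fun A hA => ?_
    rw [Finset.mem_powerset] at hA
    have hsub : H ∪ starEdges p' B ⊆ edgesOn (insert p' R) :=
      Finset.union_subset (hH.trans (edgesOn_mono (Finset.subset_insert _ _)))
        (starEdges_subset_edgesOn hp'R hB)
    simp only [nonCross_insert_adjacent_edge hlt hgap hH]
    split_ifs
    · rw [Finset.prod_union (disjoint_starEdges hp hsub),
        Finset.prod_union (disjoint_starEdges hp hsub),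
        Finset.prod_union (disjoint_starEdges hp'R hH), prod_starEdges, prod_starEdges,
        prod_starEdges, Finset.prod_insert fun h => hp'R (hA h)]
      ring
    · simp
  rw [Finset.sum_congr rfl hterm]
  split_ifs with hN
  · rw [splitSum, ← sum_powerset_visible, Finset.mul_sum, Finset.mul_sum]
    refine Finset.sum_congr rfl fun B hB => ?_
    rw [Finset.mem_powerset] at hB
    rw [← sum_powerset_visible]
    have hcongr : ∀ A ∈ R.powerset, (if NonCross (H ∪ starEdges p' B ∪ starEdges p A) then
        (1 + w s(p, p')) *
          ((∏ e ∈ H, w e) * ((∏ y ∈ B, w s(p', y)) * ∏ x ∈ A, w s(p, x))) else 0) =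
        if ∀ y ∈ B, ∀ c d, s(c, d) ∈ H → ¬ Crosses p y c d then
          (1 + w s(p, p')) * ((∏ e ∈ H, w e) *
            if ∀ x ∈ A, ∀ c d, s(c, d) ∈ H → ¬ Crosses p x c d then
              if ∀ x ∈ A, ∀ y ∈ B, cyclicPos p y ≤ cyclicPos p x then
                (∏ y ∈ B, w s(p', y)) * ∏ x ∈ A, w s(p, x) else 0
            else 0) else 0 := by
      intro A hA
      rw [Finset.mem_powerset] at hA
      simp only [nonCross_two_starEdges hlt hgap hH hA hB, hN, true_and, ite_and, mul_ite, mul_zero]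
    rw [Finset.sum_congr rfl hcongr]
    split_ifs
    · rw [Finset.mul_sum, Finset.mul_sum]
      congr!
    · simp
  · rw [mul_zero]
    refine Finset.sum_eq_zero fun B _ => Finset.sum_eq_zero fun A _ => if_neg fun h => hN ?_
    exact h.mono (Finset.subset_union_left.trans Finset.subset_union_left)

end Adjacent

/-- The full graph sum `(∏ m(z_s)) Σ_{Γ ∈ NCG(S)} q_Γ`. -/
noncomputable def fullSum (S : Finset (Fin k)) (z : Fin k → ℂ) : ℂ :=
  (∏ s ∈ S, msc (z s)) * ncSum S (qweight z)

theorem qweight_mk (z : Fin k → ℂ) (i j : Fin k) :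
    qweight z s(i, j) = msc (z i) * msc (z j) / (1 - msc (z i) * msc (z j)) := rfl

theorem fullSum_adjacent {z : Fin k → ℂ} (hz : ∀ s, (z s).im ≠ 0) {p p' : Fin k}
    {R : Finset (Fin k)} (hlt : p < p') (hgap : ∀ x ∈ R, x < p ∨ p' < x) :
    (z p' - z p) * fullSum (insert p (insert p' R)) z =
      fullSum (insert p' R) z - fullSum (insert p R) z := by
  have hp'R : p' ∉ R := fun h => by
    rcases hgap _ h with h | h
    · exact absurd h hlt.le.not_gt
    · exact lt_irrefl _ h
  have hpR : p ∉ R := fun h => by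
    rcases hgap _ h with h | h
    · exact lt_irrefl _ h
    · exact absurd h hlt.le.not_gt
  have hp : p ∉ insert p' R := by
    rw [Finset.mem_insert, not_or]
    exact ⟨hlt.ne, hpR⟩
  have hne : ∀ i j, 1 - msc (z i) * msc (z j) ≠ 0 := fun i j =>
    one_sub_msc_mul_ne_zero (hz i) (hz j)
  have hmain : (msc (z p) - msc (z p')) * (∑ H ∈ (edgesOn R).powerset,
      open scoped Classical in
      if NonCross H then (∏ e ∈ H, qweight z e) *
        splitSum (cyclicPos p) (fun x => qweight z s(p', x)) (fun x => qweight z s(p, x))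
          (visible p R H)
      else 0) = msc (z p) * ncSum (insert p R) (qweight z) -
        msc (z p') * ncSum (insert p' R) (qweight z) := by
    classical
    rw [ncSum_insert hpR, ncSum_insert hp'R, Finset.mul_sum, Finset.mul_sum, Finset.mul_sum,
      ← Finset.sum_sub_distrib]
    refine Finset.sum_congr rfl fun H hH => ?_
    rw [Finset.mem_powerset] at hH
    split_ifs
    · have h := splitSum_eq (cyclicPos_injective p) (msc (z p)) (msc (z p'))
        (fun x => msc (z x)) (visible p R H) (fun x _ => hne p x) (fun x _ => hne p' x)
      simp only [qweight_mk, visible_eq_of_adjacent hlt hgap hH]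
      linear_combination (∏ e ∈ H, qweight z e) * h
    · simp
  rw [fullSum, fullSum, fullSum, ncSum_insert_insert hlt hgap, Finset.prod_insert hp,
    Finset.prod_insert hpR, Finset.prod_insert hp'R, qweight_mk]
  have hq := sub_mul_msc_mul_msc (hz p) (hz p')
  have hinv := mul_inv_cancel₀ (hne p p')
  rw [div_eq_mul_inv]
  generalize (1 - msc (z p) * msc (z p'))⁻¹ = y at *
  have hy : 1 + msc (z p) * msc (z p') * y = y := by linear_combination -hinv
  rw [hy]
  generalize (∑ H ∈ (edgesOn R).powerset, _ : ℂ) = T at *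
  linear_combination (-(∏ s ∈ R, msc (z s))) * hmain - (∏ s ∈ R, msc (z s)) * y * T * hq -
    (∏ s ∈ R, msc (z s)) * T * (msc (z p) - msc (z p')) * hinv

theorem fullSum_erase {z : Fin k → ℂ} (hz : ∀ s, (z s).im ≠ 0) {p p' : Fin k}
    {S : Finset (Fin k)} (hp : p ∈ S) (hp' : p' ∈ S) (hlt : p < p')
    (hgap : ∀ x ∈ S, x ≤ p ∨ p' ≤ x) :
    (z p' - z p) * fullSum S z = fullSum (S.erase p) z - fullSum (S.erase p') z := by
  have hp'e : p' ∈ S.erase p := Finset.mem_erase.mpr ⟨hlt.ne', hp'⟩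
  have hpe : p ∈ S.erase p' := Finset.mem_erase.mpr ⟨hlt.ne, hp⟩
  have h := fullSum_adjacent hz (R := (S.erase p).erase p') hlt fun x hx => by
    simp only [Finset.mem_erase] at hx
    exact (hgap x hx.2.2).imp (fun h => lt_of_le_of_ne h hx.2.1)
      fun h => lt_of_le_of_ne h hx.1.symm
  rwa [Finset.insert_erase hp'e, Finset.insert_erase hp, Finset.erase_right_comm,
    Finset.insert_erase hpe] at h

theorem fullSum_congr {S : Finset (Fin k)} {z z' : Fin k → ℂ} (h : ∀ s ∈ S, z s = z' s) :
    fullSum S z = fullSum S z' := by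
  classical
  rw [fullSum, fullSum, Finset.prod_congr rfl fun s hs => by rw [h s hs], ncSum, ncSum]
  congr 1
  refine Finset.sum_congr rfl fun E hE => ?_
  congr 1
  refine Finset.prod_congr rfl fun e he => ?_
  have heS := Finset.mem_powerset.mp hE he
  induction e with
  | _ a b =>
    obtain ⟨ha, hb, -⟩ := mk_mem_edgesOn.mp heS
    rw [qweight_mk, qweight_mk, h a ha, h b hb]

theorem fullSum_singleton (s : Fin k) (z : Fin k → ℂ) : fullSum {s} z = msc (z s) := by
  have h : edgesOn ({s} : Finset (Fin k)) = ∅ := by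
    ext e
    induction e with
    | _ a b => simp [mk_mem_edgesOn]; rintro rfl; exact Eq.symm
  have hN : NonCross (∅ : Finset (Sym2 (Fin k))) := fun _ _ _ _ h => absurd h (by simp)
  simp [fullSum, ncSum, h, hN]

theorem continuousAt_fullSum {S : Finset (Fin k)} {z : ℂ → Fin k → ℂ} {h₀ : ℂ}
    (hz : ∀ s, ContinuousAt (fun h => z h s) h₀) (him : ∀ s, (z h₀ s).im ≠ 0) :
    ContinuousAt (fun h => fullSum S (z h)) h₀ := by
  classical
  have hm : ∀ s, ContinuousAt (fun h => msc (z h s)) h₀ := fun s =>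
    ContinuousAt.comp (f := fun h => z h s) (continuousAt_msc (him s)) (hz s)
  have hq : ∀ e, ContinuousAt (fun h => qweight (z h) e) h₀ := by
    intro e
    induction e with
    | _ a b =>
      exact ((hm a).mul (hm b)).div (continuousAt_const.sub ((hm a).mul (hm b)))
        (one_sub_msc_mul_ne_zero (him a) (him b))
  unfold fullSum ncSum
  refine ContinuousAt.mul (tendsto_finsetProd _ fun s _ => hm s) (tendsto_finsetSum _ fun E _ => ?_)
  split_ifs
  · exact tendsto_finsetProd _ fun e _ => hq e
  · exact tendsto_const_nhds

/-- Moving all points of `S` from `w` to `w + h` one at a time. -/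
theorem fullSum_telescope {n : ℕ} {S : Finset (Fin k)} (hS : S.card = n + 2) {w h : ℂ}
    (hw : w.im ≠ 0) (hwh : (w + h).im ≠ 0) :
    h * ∑ i : Fin (n + 1), fullSum S
        (fun s => if s ≤ S.orderEmbOfFin hS i.castSucc then w + h else w) =
      fullSum (S.erase (S.orderEmbOfFin hS (Fin.last _))) (fun _ => w + h) -
        fullSum (S.erase (S.orderEmbOfFin hS 0)) (fun _ => w) := by
  set e := S.orderEmbOfFin hS with he
  have hmem : ∀ i, e i ∈ S := Finset.orderEmbOfFin_mem S hS
  have hsurj : ∀ x ∈ S, ∃ j, e j = x := fun x hx => by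
    have : x ∈ Set.range e := by rw [he, Finset.range_orderEmbOfFin]; exact hx
    exact this
  set f : Fin (n + 2) → ℂ := fun i =>
    fullSum (S.erase (e i)) (fun s => if s ≤ e i then w + h else w) with hf
  have hlast : f (Fin.last _) = fullSum (S.erase (e (Fin.last _))) (fun _ => w + h) := by
    refine fullSum_congr fun s hs => if_pos ?_
    obtain ⟨j, rfl⟩ := hsurj s (Finset.mem_of_mem_erase hs)
    exact e.monotone (Fin.le_last j)
  have hzero : f 0 = fullSum (S.erase (e 0)) (fun _ => w) := by
    refine fullSum_congr fun s hs => if_neg ?_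
    obtain ⟨j, rfl⟩ := hsurj s (Finset.mem_of_mem_erase hs)
    exact fun hle => Finset.ne_of_mem_erase hs (le_antisymm hle (e.monotone (Fin.zero_le j)))
  have hstep : ∀ i : Fin (n + 1), h * fullSum S (fun s => if s ≤ e i.castSucc then w + h else w) =
      f i.succ - f i.castSucc := by
    intro i
    have hlt : e i.castSucc < e i.succ := e.strictMono Fin.castSucc_lt_succ
    have hgap : ∀ x ∈ S, x ≤ e i.castSucc ∨ e i.succ ≤ x := by
      intro x hx
      obtain ⟨j, rfl⟩ := hsurj x hx
      rw [e.le_iff_le, e.le_iff_le]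
      rcases le_or_gt j i.castSucc with hj | hj
      · exact Or.inl hj
      · exact Or.inr (Fin.castSucc_lt_iff_succ_le.mp hj)
    have hrec := fullSum_erase (z := fun s => if s ≤ e i.castSucc then w + h else w)
      (fun s => by split_ifs; exacts [hwh, hw]) (hmem _) (hmem _) hlt hgap
    have hcongr : fullSum (S.erase (e i.succ))
        (fun s => if s ≤ e i.castSucc then w + h else w) = f i.succ := by
      refine fullSum_congr fun s hs => ?_
      obtain ⟨hne, hs⟩ := Finset.mem_erase.mp hs
      congr 1
      rw [eq_iff_iff]
      refine ⟨fun h => h.trans hlt.le, fun h => (hgap s hs).resolve_right fun h' => hne ?_⟩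
      exact le_antisymm h h'
    simp only [le_refl, if_true, if_neg hlt.not_ge, hcongr] at hrec
    rw [hf] at hrec ⊢
    linear_combination -hrec
  rw [Finset.mul_sum, Finset.sum_congr rfl fun i _ => hstep i, Finset.sum_sub_distrib]
  have h1 := Fin.sum_univ_castSucc f
  have h2 := Fin.sum_univ_succ f
  linear_combination h1 - h2 + hlast - hzero

theorem fullSum_const (n : ℕ) : ∀ (S : Finset (Fin k)), S.card = n + 1 → ∀ w : ℂ, w.im ≠ 0 →
    fullSum S (fun _ => w) = iteratedDeriv n msc w / n.factorial := by
  induction n with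
  | zero =>
    intro S hS w _
    obtain ⟨s, rfl⟩ := Finset.card_eq_one.mp hS
    simp [fullSum_singleton]
  | succ n ih =>
    intro S hS w hw
    have hcard : ∀ i, (S.erase (S.orderEmbOfFin hS i)).card = n + 1 := fun i => by
      rw [Finset.card_erase_of_mem (Finset.orderEmbOfFin_mem S hS i), hS]; rfl
    have hfac : (n.factorial : ℂ) ≠ 0 := by exact_mod_cast n.factorial_ne_zero
    have hder : HasDerivAt (iteratedDeriv n msc)
        (n.factorial * ((n + 1) * fullSum S (fun _ => w))) w := by
      rw [hasDerivAt_iff_tendsto_slope_zero]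
      have hlim : Filter.Tendsto (fun h : ℂ => (n.factorial : ℂ) * ∑ i : Fin (n + 1), fullSum S
          (fun s => if s ≤ S.orderEmbOfFin hS i.castSucc then w + h else w))
          (nhds 0) (nhds (n.factorial * ((n + 1) * fullSum S (fun _ => w)))) := by
        refine Filter.Tendsto.const_mul _ ?_
        have hsum : ((n : ℂ) + 1) * fullSum S (fun _ => w) =
            ∑ _i : Fin (n + 1), fullSum S (fun _ => w) := by simp
        rw [hsum]
        refine tendsto_finsetSum _ fun i _ => ?_
        have hc := continuousAt_fullSum (S := S) (h₀ := 0)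
          (z := fun h s => if s ≤ S.orderEmbOfFin hS i.castSucc then w + h else w)
          (fun s => by split_ifs <;> fun_prop) (fun s => by simpa using hw)
        simpa [ContinuousAt] using hc
      refine (hlim.mono_left nhdsWithin_le_nhds).congr' ?_
      have hev : ∀ᶠ h : ℂ in nhds 0, (w + h).im ≠ 0 := by
        have : ContinuousAt (fun h : ℂ => (w + h).im) 0 := by fun_prop
        exact this.eventually_ne (by simpa using hw)
      filter_upwards [self_mem_nhdsWithin, nhdsWithin_le_nhds hev] with h hh0 hh
      have htel := fullSum_telescope hS hw hh
      rw [ih _ (hcard _) _ hh, ih _ (hcard _) _ hw] at htel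
      have hh0 : h ≠ 0 := hh0
      rw [smul_eq_mul, eq_inv_mul_iff_mul_eq₀ hh0, mul_left_comm, htel]
      field_simp
    rw [iteratedDeriv_succ, hder.deriv, Nat.factorial_succ]
    have hn : ((n : ℂ) + 1) ≠ 0 := by exact_mod_cast n.succ_ne_zero
    push_cast
    field_simp

section DividedDifference

variable {dd : List ℂ → ℂ}

theorem dd_perm (hrec : ∀ (l : List ℂ) (a b : ℂ), a ∈ l → b ∈ l → a ≠ b →
      dd l = (dd (l.erase a) - dd (l.erase b)) / (b - a)) (n : ℕ) :
    ∀ l l' : List ℂ, l.length = n → l.Perm l' → dd l = dd l' := by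
  induction n with
  | zero =>
    intro l l' hl hp
    rw [List.length_eq_zero_iff] at hl
    subst hl
    rw [List.nil_perm.mp hp]
  | succ n ih =>
    intro l l' hl hp
    by_cases h : ∃ a ∈ l, ∃ b ∈ l, a ≠ b
    · obtain ⟨a, ha, b, hb, hab⟩ := h
      rw [hrec l a b ha hb hab, hrec l' a b (hp.mem_iff.mp ha) (hp.mem_iff.mp hb) hab,
        ih _ _ (by rw [List.length_erase_of_mem ha, hl]; rfl) (hp.erase a),
        ih _ _ (by rw [List.length_erase_of_mem hb, hl]; rfl) (hp.erase b)]
    · push Not at h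
      obtain ⟨a, ha⟩ := List.exists_mem_of_length_pos (l := l) (by omega)
      have hrepl : l = List.replicate l.length a := List.eq_replicate_of_mem fun b hb => h b hb a ha
      rw [hrepl] at hp ⊢
      rw [List.replicate_perm.mp hp]

theorem exists_adjacent_ne {z : Fin k → ℂ} {S : Finset (Fin k)} {x y : Fin k} (hx : x ∈ S)
    (hy : y ∈ S) (hxy : x < y) (hne : z x ≠ z y) :
    ∃ p ∈ S, ∃ p' ∈ S, p < p' ∧ (∀ s ∈ S, s ≤ p ∨ p' ≤ s) ∧ z p ≠ z p' := by
  obtain ⟨p', hp', hmin⟩ := (S.filter fun s => x < s ∧ z s ≠ z x).exists_min_image id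
    ⟨y, Finset.mem_filter.mpr ⟨hy, hxy, hne.symm⟩⟩
  obtain ⟨hp'S, hxp', hp'z⟩ := Finset.mem_filter.mp hp'
  obtain ⟨p, hp, hmax⟩ := (S.filter fun s => s < p').exists_max_image id
    ⟨x, Finset.mem_filter.mpr ⟨hx, hxp'⟩⟩
  obtain ⟨hpS, hpp'⟩ := Finset.mem_filter.mp hp
  have hxp : x ≤ p := hmax x (Finset.mem_filter.mpr ⟨hx, hxp'⟩)
  have hzp : z p = z x := by
    rcases hxp.eq_or_lt with rfl | hlt
    · rfl
    · by_contra hzp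
      exact hpp'.not_ge (hmin p (Finset.mem_filter.mpr ⟨hpS, hlt, hzp⟩))
  refine ⟨p, hpS, p', hp'S, hpp', fun s hs => ?_, fun h => hp'z (h ▸ hzp)⟩
  rcases lt_or_ge s p' with hs' | hs'
  · exact Or.inl (hmax s (Finset.mem_filter.mpr ⟨hs, hs'⟩))
  · exact Or.inr hs'

theorem map_sort_erase_perm (z : Fin k → ℂ) {S : Finset (Fin k)} {p : Fin k} (hp : p ∈ S) :
    (((S.sort (· ≤ ·)).map z).erase (z p)).Perm (((S.erase p).sort (· ≤ ·)).map z) := by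
  rw [← Multiset.coe_eq_coe, ← Multiset.coe_erase, ← Multiset.map_coe, ← Multiset.map_coe,
    Finset.sort_eq, Finset.sort_eq, Finset.erase_val]
  exact (Multiset.map_erase_of_mem z S.1 hp).symm

/-- The divided differences of `msc` are given by the sum over non-crossing graphs. -/
theorem dd_eq_fullSum
    (hrec : ∀ (l : List ℂ) (a b : ℂ), a ∈ l → b ∈ l → a ≠ b →
      dd l = (dd (l.erase a) - dd (l.erase b)) / (b - a))
    (hrep : ∀ (w : ℂ) (m : ℕ),
      dd (List.replicate (m + 1) w) = iteratedDeriv m msc w / (m.factorial : ℂ))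
    {z : Fin k → ℂ} (hz : ∀ s, (z s).im ≠ 0) (S : Finset (Fin k)) (hS : S.Nonempty) :
    dd ((S.sort (· ≤ ·)).map z) = fullSum S z := by
  induction S using Finset.strongInduction with
  | H S ih =>
    by_cases h : ∃ x ∈ S, ∃ y ∈ S, x < y ∧ z x ≠ z y
    · obtain ⟨x, hx, y, hy, hxy, hne⟩ := h
      obtain ⟨p, hp, p', hp', hlt, hgap, hpz⟩ := exists_adjacent_ne hx hy hxy hne
      have hmem : ∀ s ∈ S, z s ∈ (S.sort (· ≤ ·)).map z := fun s hs =>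
        List.mem_map_of_mem ((Finset.mem_sort _).mpr hs)
      rw [hrec _ _ _ (hmem p hp) (hmem p' hp') hpz,
        dd_perm hrec _ _ _ rfl (map_sort_erase_perm z hp),
        dd_perm hrec _ _ _ rfl (map_sort_erase_perm z hp'),
        ih _ (Finset.erase_ssubset hp) ⟨p', Finset.mem_erase.mpr ⟨hlt.ne', hp'⟩⟩,
        ih _ (Finset.erase_ssubset hp') ⟨p, Finset.mem_erase.mpr ⟨hlt.ne, hp⟩⟩,
        ← fullSum_erase hz hp hp' hlt hgap, mul_div_cancel_left₀]
      exact sub_ne_zero.mpr hpz.symm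
    · push Not at h
      obtain ⟨x, hx⟩ := hS
      have hconst : ∀ s ∈ S, z s = z x := by
        intro s hs
        rcases lt_trichotomy s x with hsx | rfl | hsx
        · exact h s hs x hx hsx
        · rfl
        · exact (h x hx s hs hsx).symm
      obtain ⟨n, hn⟩ := Nat.exists_eq_succ_of_ne_zero (Finset.card_ne_zero_of_mem hx)
      have hlist : (S.sort (· ≤ ·)).map z = List.replicate (n + 1) (z x) := by
        rw [List.eq_replicate_iff]
        refine ⟨by rw [List.length_map, Finset.length_sort, hn], fun b hb => ?_⟩
        obtain ⟨s, hs, rfl⟩ := List.mem_map.mp hb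
        exact hconst s ((Finset.mem_sort _).mp hs)
      rw [hlist, hrep, fullSum_congr hconst, fullSum_const n S hn _ (hz x)]

end DividedDifference

/-- Reachability along the edges of `E`. -/
def Reach (E : Finset (Sym2 (Fin k))) : Fin k → Fin k → Prop :=
  Relation.ReflTransGen fun a b => s(a, b) ∈ E

theorem Reach.symm {E : Finset (Sym2 (Fin k))} {a b : Fin k} (h : Reach E a b) : Reach E b a :=
  have : Std.Symm fun a b => s(a, b) ∈ E := ⟨fun _ _ h => Sym2.eq_swap ▸ h⟩
  (Relation.ReflTransGen.stdSymm (r := fun a b => s(a, b) ∈ E)).symm _ _ h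

theorem Reach.trans {E : Finset (Sym2 (Fin k))} {a b c : Fin k} (h : Reach E a b)
    (h' : Reach E b c) : Reach E a c :=
  Relation.ReflTransGen.trans h h'

theorem Reach.mono {E F : Finset (Sym2 (Fin k))} {a b : Fin k} (h : Reach E a b) (hEF : E ⊆ F) :
    Reach F a b :=
  Relation.ReflTransGen.mono (fun _ _ h => hEF h) _ _ h

theorem Reach.of_mem {E : Finset (Sym2 (Fin k))} {a b : Fin k} (h : s(a, b) ∈ E) : Reach E a b :=
  Relation.ReflTransGen.single h

theorem Reach.exists_edge {E : Finset (Sym2 (Fin k))} {c d : Fin k} (P : Fin k → Prop)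
    (h : Reach E c d) (hc : P c) (hd : ¬ P d) :
    ∃ u v, s(u, v) ∈ E ∧ Reach E c u ∧ Reach E c v ∧ P u ∧ ¬ P v := by
  induction h with
  | refl => exact absurd hc hd
  | @tail b d hb hbd ih =>
    by_cases hPb : P b
    · exact ⟨b, d, hbd, hb, hb.tail hbd, hPb, hd⟩
    · exact ih hPb

open scoped Classical in
/-- The non-crossing graphs on `B`, as edge sets, that connect all the elements of `B`. -/
noncomputable def connGraphs (B : Finset (Fin k)) : Finset (Finset (Sym2 (Fin k))) :=
  {E ∈ (edgesOn B).powerset | NonCross E ∧ ∀ a ∈ B, ∀ b ∈ B, Reach E a b}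

/-- The weighted sum over connected non-crossing graphs on `B`. -/
noncomputable def connSum (B : Finset (Fin k)) (w : Sym2 (Fin k) → ℂ) : ℂ :=
  ∑ E ∈ connGraphs B, ∏ e ∈ E, w e

theorem mem_connGraphs {B : Finset (Fin k)} {E : Finset (Sym2 (Fin k))} :
    E ∈ connGraphs B ↔ E ⊆ edgesOn B ∧ NonCross E ∧ ∀ a ∈ B, ∀ b ∈ B, Reach E a b := by
  simp [connGraphs]

open scoped Classical in
/-- The partition of `S` into the connected components of `E`. -/
noncomputable def components (E : Finset (Sym2 (Fin k))) (S : Finset (Fin k)) : Finpartition S :=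
  Finpartition.ofSetSetoid
    ⟨Reach E, fun _ => Relation.ReflTransGen.refl, Reach.symm, Reach.trans⟩ S

theorem sameBlock_iff_mem_part {S : Finset (Fin k)} {π : Finpartition S} {a b : Fin k} :
    SameBlock π a b ↔ b ∈ π.part a := by
  rw [Finpartition.mem_part_iff_exists]
  simp only [SameBlock, and_comm]

theorem sameBlock_components {E : Finset (Sym2 (Fin k))} {S : Finset (Fin k)} {a b : Fin k} :
    SameBlock (components E S) a b ↔ a ∈ S ∧ b ∈ S ∧ Reach E a b := by
  classical
  rw [sameBlock_iff_mem_part]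
  exact Finpartition.mem_part_ofSetSetoid_iff_rel S

theorem finpartition_ext {S : Finset (Fin k)} {π ρ : Finpartition S}
    (h : ∀ a b, SameBlock π a b ↔ SameBlock ρ a b) : π = ρ := by
  have key : ∀ {π ρ : Finpartition S}, (∀ a b, SameBlock π a b ↔ SameBlock ρ a b) →
      π.parts ⊆ ρ.parts := by
    intro π ρ h B hB
    obtain ⟨a, ha⟩ := π.nonempty_of_mem_parts hB
    have : B = ρ.part a := by
      rw [← π.part_eq_of_mem hB ha]
      ext b
      rw [← sameBlock_iff_mem_part, ← sameBlock_iff_mem_part, h]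
    rw [this, Finpartition.part_mem]
    exact π.subset hB ha
  exact Finpartition.ext ((key h).antisymm (key fun a b => (h a b).symm))

theorem isNoncrossing_components {E : Finset (Sym2 (Fin k))} {S : Finset (Fin k)}
    (hE : NonCross E) : IsNoncrossing (components E S) := by
  intro a b c d hac hcb hbd hab hcd
  rw [sameBlock_components] at *
  refine ⟨hab.1, hcd.1, ?_⟩
  by_contra hn
  obtain ⟨x, y, hxy, hax, hay, hx, hy⟩ :=
    hab.2.2.exists_edge (fun x => ¬ (c < x ∧ x < d)) (by simp [hac.le]) (by simp [hcb, hbd])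
  have hne : ∀ {u v}, Reach E a u → Reach E c v → v ≠ u := by
    rintro u v hu hv rfl
    exact hn (hu.trans hv.symm)
  have hxc := hne hax .refl
  have hxd := hne hax hcd.2.2
  have hfin : ∀ u v, s(u, v) ∈ E → Reach E c u → Reach E c v →
      ((x < u ∧ u < y) ∨ (y < u ∧ u < x)) → ¬ ((x < v ∧ v < y) ∨ (y < v ∧ v < x)) → False := by
    intro u v huv hu hv h1 h2
    refine hE x y u v hxy huv ?_
    have h3 := hne hax hv
    have h4 := hne hay hv
    simp only [Crosses, Fin.lt_def, Ne, Fin.ext_iff] at *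
    omega
  have hR := hcd.2.2
  by_cases hlt : x < c
  · obtain ⟨u, v, huv, hu, hv, h1, h2⟩ :=
      hR.exists_edge (fun u => (x < u ∧ u < y) ∨ (y < u ∧ u < x))
        (by simp only [Fin.lt_def, Ne, Fin.ext_iff] at *; omega)
        (by simp only [Fin.lt_def, Ne, Fin.ext_iff] at *; omega)
    exact hfin u v huv hu hv h1 h2
  · obtain ⟨u, v, huv, hu, hv, h1, h2⟩ :=
      hR.exists_edge (fun u => ¬ ((x < u ∧ u < y) ∨ (y < u ∧ u < x)))
        (by simp only [Fin.lt_def, Ne, Fin.ext_iff] at *; omega)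
        (by simp only [Fin.lt_def, Ne, Fin.ext_iff] at *; omega)
    exact hfin v u (Sym2.eq_swap ▸ huv) hv hu (not_not.mp h2) h1

theorem reach_inter_edgesOn {E : Finset (Sym2 (Fin k))} {S B : Finset (Fin k)}
    (hE : E ⊆ edgesOn S) (hB : B ∈ (components E S).parts) {a b : Fin k} (ha : a ∈ B)
    (h : Reach E a b) : b ∈ B ∧ Reach (E ∩ edgesOn B) a b := by
  induction h with
  | refl => exact ⟨ha, .refl⟩
  | @tail b c _ hbc ih =>
    obtain ⟨hb, hab⟩ := ih
    obtain ⟨hbS, hcS, hne⟩ := mk_mem_edgesOn.mp (hE hbc)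
    have hc : c ∈ B := by
      obtain ⟨B', hB', hb', hc'⟩ := sameBlock_components.mpr ⟨hbS, hcS, Reach.of_mem hbc⟩
      rwa [Finpartition.eq_of_mem_parts _ hB hB' hb hb']
    exact ⟨hc, hab.tail (Finset.mem_inter.mpr ⟨hbc, mk_mem_edgesOn.mpr ⟨hb, hc, hne⟩⟩)⟩

theorem inter_edgesOn_mem_connGraphs {E : Finset (Sym2 (Fin k))} {S B : Finset (Fin k)}
    (hE : E ⊆ edgesOn S) (hnc : NonCross E) (hB : B ∈ (components E S).parts) :
    E ∩ edgesOn B ∈ connGraphs B := by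
  refine mem_connGraphs.mpr ⟨Finset.inter_subset_right, hnc.mono Finset.inter_subset_left, ?_⟩
  intro a ha b hb
  exact (reach_inter_edgesOn hE hB ha (sameBlock_components.mp ⟨B, hB, ha, hb⟩).2.2).2

theorem exists_mem_edgesOn_of_mem {E : Finset (Sym2 (Fin k))} {S : Finset (Fin k)}
    (hE : E ⊆ edgesOn S) {e : Sym2 (Fin k)} (he : e ∈ E) :
    ∃ B ∈ (components E S).parts, e ∈ edgesOn B := by
  induction e with | _ a b =>
  obtain ⟨ha, hb, hne⟩ := mk_mem_edgesOn.mp (hE he)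
  obtain ⟨B, hB, haB, hbB⟩ := sameBlock_components.mpr ⟨ha, hb, Reach.of_mem he⟩
  exact ⟨B, hB, mk_mem_edgesOn.mpr ⟨haB, hbB, hne⟩⟩

theorem eq_of_mem_edgesOn {S : Finset (Fin k)} (π : Finpartition S) {B B' : Finset (Fin k)}
    (hB : B ∈ π.parts) (hB' : B' ∈ π.parts) {e : Sym2 (Fin k)} (he : e ∈ edgesOn B)
    (he' : e ∈ edgesOn B') : B = B' := by
  induction e with | _ a b =>
  exact π.eq_of_mem_parts hB hB' (mk_mem_edgesOn.mp he).1 (mk_mem_edgesOn.mp he').1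

/-- The union of a family of graphs on the blocks of a partition. -/
def glue {S : Finset (Fin k)} (π : Finpartition S)
    (g : ∀ B ∈ π.parts, Finset (Sym2 (Fin k))) : Finset (Sym2 (Fin k)) :=
  π.parts.attach.biUnion fun B => g B.1 B.2

section Glue

variable {S : Finset (Fin k)} {π : Finpartition S} {g : ∀ B ∈ π.parts, Finset (Sym2 (Fin k))}

theorem mem_glue {e : Sym2 (Fin k)} : e ∈ glue π g ↔ ∃ B, ∃ hB : B ∈ π.parts, e ∈ g B hB := by
  simp [glue]

theorem glue_subset (hg : ∀ B hB, g B hB ∈ connGraphs B) : glue π g ⊆ edgesOn S := by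
  intro e he
  obtain ⟨B, hB, he⟩ := mem_glue.mp he
  exact edgesOn_mono (π.subset hB) ((mem_connGraphs.mp (hg B hB)).1 he)

theorem glue_inter_edgesOn (hg : ∀ B hB, g B hB ∈ connGraphs B) {B : Finset (Fin k)}
    (hB : B ∈ π.parts) : glue π g ∩ edgesOn B = g B hB := by
  ext e
  rw [Finset.mem_inter, mem_glue]
  constructor
  · rintro ⟨⟨B', hB', he⟩, heB⟩
    obtain rfl := eq_of_mem_edgesOn π hB hB' heB ((mem_connGraphs.mp (hg B' hB')).1 he)
    exact he
  · exact fun he => ⟨⟨B, hB, he⟩, (mem_connGraphs.mp (hg B hB)).1 he⟩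

theorem nonCross_glue (hπ : IsNoncrossing π) (hg : ∀ B hB, g B hB ∈ connGraphs B) :
    NonCross (glue π g) := by
  rw [nonCross_iff]
  intro a b c d hac hcb hbd hab hcd
  obtain ⟨B, hB, hab⟩ := mem_glue.mp hab
  obtain ⟨B', hB', hcd⟩ := mem_glue.mp hcd
  have h1 := mk_mem_edgesOn.mp ((mem_connGraphs.mp (hg B hB)).1 hab)
  have h2 := mk_mem_edgesOn.mp ((mem_connGraphs.mp (hg B' hB')).1 hcd)
  obtain ⟨D, hD, ha, hc⟩ := hπ a b c d hac hcb hbd ⟨B, hB, h1.1, h1.2.1⟩ ⟨B', hB', h2.1, h2.2.1⟩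
  obtain rfl := π.eq_of_mem_parts hB hD h1.1 ha
  obtain rfl := π.eq_of_mem_parts hB' hB h2.1 hc
  exact nonCross_iff.mp (mem_connGraphs.mp (hg B' hB')).2.1 a b c d hac hcb hbd hab hcd

theorem components_glue (hg : ∀ B hB, g B hB ∈ connGraphs B) : components (glue π g) S = π := by
  refine finpartition_ext fun a b => ?_
  rw [sameBlock_components]
  constructor
  · rintro ⟨ha, -, hab⟩
    induction hab with
    | refl =>
      obtain ⟨B, hB, haB⟩ := π.exists_mem ha
      exact ⟨B, hB, haB, haB⟩
    | tail _ hbc ih =>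
      obtain ⟨B, hB, haB, hbB⟩ := ih
      obtain ⟨B', hB', hbc⟩ := mem_glue.mp hbc
      have h := mk_mem_edgesOn.mp ((mem_connGraphs.mp (hg B' hB')).1 hbc)
      obtain rfl := π.eq_of_mem_parts hB hB' hbB h.1
      exact ⟨B, hB, haB, h.2.1⟩
  · rintro ⟨B, hB, ha, hb⟩
    refine ⟨π.subset hB ha, π.subset hB hb, ?_⟩
    exact ((mem_connGraphs.mp (hg B hB)).2.2 a ha b hb).mono
      fun e he => mem_glue.mpr ⟨B, hB, he⟩

theorem prod_glue (hg : ∀ B hB, g B hB ∈ connGraphs B) (w : Sym2 (Fin k) → ℂ) :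
    ∏ e ∈ glue π g, w e = ∏ B ∈ π.parts.attach, ∏ e ∈ g B.1 B.2, w e := by
  refine Finset.prod_biUnion fun B _ B' _ hne => Finset.disjoint_left.mpr fun e he he' => hne ?_
  exact Subtype.ext (eq_of_mem_edgesOn π B.2 B'.2 ((mem_connGraphs.mp (hg _ B.2)).1 he)
    ((mem_connGraphs.mp (hg _ B'.2)).1 he'))

end Glue

theorem glue_inter_components {E : Finset (Sym2 (Fin k))} {S : Finset (Fin k)}
    (hE : E ⊆ edgesOn S) : glue (components E S) (fun B _ => E ∩ edgesOn B) = E := by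
  ext e
  rw [mem_glue]
  constructor
  · rintro ⟨B, hB, he⟩
    exact (Finset.mem_inter.mp he).1
  · intro he
    obtain ⟨B, hB, heB⟩ := exists_mem_edgesOn_of_mem hE he
    exact ⟨B, hB, Finset.mem_inter.mpr ⟨he, heB⟩⟩

open scoped Classical in
theorem sum_components_eq {S : Finset (Fin k)} {π : Finpartition S} (hπ : IsNoncrossing π)
    (w : Sym2 (Fin k) → ℂ) :
    ∑ E ∈ {E ∈ (edgesOn S).powerset | NonCross E} with components E S = π, ∏ e ∈ E, w e =
      ∏ B ∈ π.parts, connSum B w := by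
  simp only [connSum]
  rw [Finset.prod_sum]
  have hpi : ∀ g : (∀ B ∈ π.parts, Finset (Sym2 (Fin k))),
      g ∈ π.parts.pi (fun B => connGraphs B) ↔ ∀ B hB, g B hB ∈ connGraphs B :=
    fun g => Finset.mem_pi
  refine Finset.sum_bij' (fun E _ B _ => E ∩ edgesOn B) (fun g _ => glue π g) ?_ ?_ ?_ ?_ ?_
  · intro E hE
    simp only [Finset.mem_filter, Finset.mem_powerset] at hE
    obtain ⟨⟨hES, hnc⟩, rfl⟩ := hE
    exact (hpi _).mpr fun B hB => inter_edgesOn_mem_connGraphs hES hnc hB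
  · intro g hg
    rw [hpi] at hg
    simp only [Finset.mem_filter, Finset.mem_powerset]
    exact ⟨⟨glue_subset hg, nonCross_glue hπ hg⟩, components_glue hg⟩
  · intro E hE
    simp only [Finset.mem_filter, Finset.mem_powerset] at hE
    obtain ⟨⟨hES, -⟩, rfl⟩ := hE
    exact glue_inter_components hES
  · intro g hg
    rw [hpi] at hg
    funext B hB
    exact glue_inter_edgesOn hg hB
  · intro E hE
    simp only [Finset.mem_filter, Finset.mem_powerset] at hE
    obtain ⟨⟨hES, hnc⟩, rfl⟩ := hE
    conv_lhs => rw [← glue_inter_components hES]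
    exact prod_glue (fun B hB => inter_edgesOn_mem_connGraphs hES hnc hB) w

open scoped Classical in
theorem ncSum_eq_sum_prod_connSum (S : Finset (Fin k)) (w : Sym2 (Fin k) → ℂ) :
    ncSum S w = ∑ π : Finpartition S with IsNoncrossing π, ∏ B ∈ π.parts, connSum B w := by
  rw [ncSum, ← Finset.sum_filter]
  rw [← Finset.sum_fiberwise_of_maps_to (g := fun E => components E S)
    (t := {π : Finpartition S | IsNoncrossing π})]
  · refine Finset.sum_congr rfl fun π hπ => ?_
    exact sum_components_eq (Finset.mem_filter.mp hπ).2 w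
  · intro E hE
    exact Finset.mem_filter.mpr
      ⟨Finset.mem_univ _, isNoncrossing_components (Finset.mem_filter.mp hE).2⟩

/-- The weighted sum over connected non-crossing graphs, with the vertex weights included. -/
noncomputable def connFull (S : Finset (Fin k)) (z : Fin k → ℂ) : ℂ :=
  (∏ s ∈ S, msc (z s)) * connSum S (qweight z)

open scoped Classical in
theorem fullSum_eq_sum_prod_connFull (S : Finset (Fin k)) (z : Fin k → ℂ) :
    fullSum S z = ∑ π : Finpartition S with IsNoncrossing π, ∏ B ∈ π.parts, connFull B z := by
  rw [fullSum, ncSum_eq_sum_prod_connSum, Finset.mul_sum]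
  refine Finset.sum_congr rfl fun π _ => ?_
  simp only [connFull]
  rw [Finset.prod_mul_distrib]
  congr 1
  conv_lhs => rw [← π.biUnion_parts]
  exact Finset.prod_biUnion π.disjoint

open scoped Classical in
/-- The moment-cumulant relation determines the cumulants. -/
theorem eq_of_sum_noncrossing_eq {f g : Finset (Fin k) → ℂ}
    (h : ∀ S : Finset (Fin k), S.Nonempty →
      ∑ π : Finpartition S with IsNoncrossing π, ∏ B ∈ π.parts, f B =
        ∑ π : Finpartition S with IsNoncrossing π, ∏ B ∈ π.parts, g B)
    (S : Finset (Fin k)) (hS : S.Nonempty) : f S = g S := by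
  induction S using Finset.strongInduction with
  | H S ih =>
  have hmem : Finpartition.indiscrete hS.ne_empty ∈
      ({π | IsNoncrossing π} : Finset (Finpartition S)) := by
    simp only [Finset.mem_filter, Finset.mem_univ, true_and]
    rintro a b c d - - - ⟨B, hB, ha, -⟩ ⟨B', hB', hc, -⟩
    simp only [Finpartition.indiscrete_parts, Finset.mem_singleton] at hB hB'
    exact ⟨S, by simp, hB ▸ ha, hB' ▸ hc⟩
  have hS' := h S hS
  rw [← Finset.add_sum_erase _ _ hmem, ← Finset.add_sum_erase _ _ hmem] at hS'
  have hrest : ∀ π ∈ ({π | IsNoncrossing π} : Finset (Finpartition S)).erase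
      (Finpartition.indiscrete hS.ne_empty), ∏ B ∈ π.parts, f B = ∏ B ∈ π.parts, g B := by
    intro π hπ
    refine Finset.prod_congr rfl fun B hB => ih B ?_ (π.nonempty_of_mem_parts hB)
    refine (π.subset hB).ssubset_of_ne ?_
    rintro rfl
    refine (Finset.mem_erase.mp hπ).1 (Finpartition.ext ?_)
    rw [Finpartition.indiscrete_parts]
    refine Finset.eq_singleton_iff_unique_mem.mpr ⟨hB, fun B' hB' => ?_⟩
    obtain ⟨x, hx⟩ := π.nonempty_of_mem_parts hB'
    exact π.eq_of_mem_parts hB' hB hx (π.subset hB' hx)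
  rw [Finset.sum_congr rfl hrest] at hS'
  simpa using hS'

theorem finsum_cond_eq_sum_filter {ι : Type*} [Fintype ι] (p : ι → Prop) [DecidablePred p]
    (f : ι → ℂ) :
    ∑ᶠ (i : ι) (_ : p i), f i = ∑ i with p i, f i := by
  rw [finsum_eq_sum_of_fintype, Finset.sum_filter]
  exact Finset.sum_congr rfl fun i _ => finsum_eq_if

theorem connSum_univ_eq_finsum (hk : 0 < k) (w : Sym2 (Fin k) → ℂ) :
    connSum Finset.univ w = ∑ᶠ (G : SimpleGraph (Fin k)) (_ : IsNCGraph G ∧ G.Connected),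
      ∏ e ∈ (Set.toFinite G.edgeSet).toFinset, w e := by
  classical
  have : Nonempty (Fin k) := ⟨⟨0, hk⟩⟩
  rw [finsum_cond_eq_sum_filter, connSum]
  have hedge : ∀ {E : Finset (Sym2 (Fin k))}, E ⊆ edgesOn Finset.univ →
      (SimpleGraph.fromEdgeSet (E : Set (Sym2 (Fin k)))).edgeSet = E := by
    intro E hE
    rw [SimpleGraph.edgeSet_fromEdgeSet]
    refine sdiff_eq_left.mpr (Set.disjoint_left.mpr fun e he hd => ?_)
    exact (Finset.mem_filter.mp (hE he)).2 hd
  have hconn : ∀ G : SimpleGraph (Fin k), (IsNCGraph G ∧ G.Connected) ↔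
      (Set.toFinite G.edgeSet).toFinset ∈ connGraphs Finset.univ := by
    intro G
    rw [mem_connGraphs, nonCross_iff]
    simp only [Set.Finite.mem_toFinset, SimpleGraph.mem_edgeSet, Finset.mem_univ, true_imp_iff]
    rw [SimpleGraph.connected_iff]
    have hr : ∀ a b, G.Reachable a b ↔ Reach (Set.toFinite G.edgeSet).toFinset a b := by
      intro a b
      rw [SimpleGraph.reachable_iff_reflTransGen, Reach]
      simp only [Set.Finite.mem_toFinset, SimpleGraph.mem_edgeSet]
    constructor
    · rintro ⟨hnc, hc, -⟩
      refine ⟨fun e he => ?_, hnc, fun a b => (hr a b).mp (hc a b)⟩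
      induction e with | _ a b =>
      rw [Set.Finite.mem_toFinset, SimpleGraph.mem_edgeSet] at he
      exact mk_mem_edgesOn.mpr ⟨Finset.mem_univ _, Finset.mem_univ _, he.ne⟩
    · rintro ⟨-, hnc, hc⟩
      exact ⟨hnc, fun a b => (hr a b).mpr (hc a b), this⟩
  have hfrom : ∀ {E : Finset (Sym2 (Fin k))}, E ∈ connGraphs Finset.univ →
      (Set.toFinite (SimpleGraph.fromEdgeSet (E : Set (Sym2 (Fin k)))).edgeSet).toFinset = E := by
    intro E hE
    ext e
    rw [Set.Finite.mem_toFinset, hedge (mem_connGraphs.mp hE).1, Finset.mem_coe]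
  refine Finset.sum_bij' (fun E _ => SimpleGraph.fromEdgeSet (E : Set (Sym2 (Fin k))))
    (fun G _ => (Set.toFinite G.edgeSet).toFinset) ?_ ?_ ?_ ?_ ?_
  · intro E hE
    rw [Finset.mem_filter, hconn, hfrom hE]
    exact ⟨Finset.mem_univ _, hE⟩
  · intro G hG
    exact (hconn G).mp (Finset.mem_filter.mp hG).2
  · intro E hE
    exact hfrom hE
  · intro G hG
    simp
  · intro E hE
    rw [hfrom hE]

end Combinatorics

/-- Connected-graph formula for the free cumulant function of the divided differences of the
semicircle Stieltjes transform:
`m_∘[z₁,...,z_k] = (Π_s m(z_s)) · Σ_{Γ ∈ NCG_c(k)} Π_{(i,j) ∈ E(Γ)} q_{i,j}`,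
where `m_∘` is defined by the moment–cumulant relation
`m[S] = Σ_{π ∈ NCP(S)} Π_{B ∈ π} m_∘[B]` over all (nonempty) subsets `S` of `[k]`. -/
theorem free_cumulant_connected_graph_sum (k : ℕ) (hk : 0 < k)
    (z : Fin k → ℂ) (hz : ∀ s, (z s).im ≠ 0)
    (dd : List ℂ → ℂ)
    (hone : ∀ w : ℂ, dd [w] = msc w)
    (hrec : ∀ (l : List ℂ) (a b : ℂ), a ∈ l → b ∈ l → a ≠ b →
      dd l = (dd (l.erase a) - dd (l.erase b)) / (b - a))
    (hrep : ∀ (w : ℂ) (m : ℕ),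
      dd (List.replicate (m + 1) w) = iteratedDeriv m msc w / (m.factorial : ℂ))
    (mo : Finset (Fin k) → ℂ)
    (hmo : ∀ S : Finset (Fin k), S.Nonempty →
      dd ((S.sort (· ≤ ·)).map z) =
        ∑ᶠ (π : Finpartition S) (_ : IsNoncrossing π), ∏ B ∈ π.parts, mo B) :
    mo Finset.univ =
      (∏ s, msc (z s)) *
        ∑ᶠ (G : SimpleGraph (Fin k)) (_ : IsNCGraph G ∧ G.Connected),
          ∏ e ∈ (Set.toFinite G.edgeSet).toFinset, qweight z e := by
  have hmom : ∀ S : Finset (Fin k), S.Nonempty → mo S = connFull S z := by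
    classical
    refine eq_of_sum_noncrossing_eq fun S hS => ?_
    rw [← fullSum_eq_sum_prod_connFull, ← dd_eq_fullSum hrec hrep hz S hS, hmo S hS,
      finsum_cond_eq_sum_filter]
  rw [hmom Finset.univ ⟨⟨0, hk⟩, Finset.mem_univ _⟩, connFull, connSum_univ_eq_finsum hk]
end

section
/- Setting σ = ῶ_2 = 0 and applying the covariance recursion once yields the closed formula m[z_1 | z_2] = m_1' m_2' / (1 - m_1 m_2)^2 + κ_4 m_1 m_1' m_2 m_2', where m_i = m(z_i), m_i' = m'(z_i). -/
open MeasureTheory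

open Complex Metric in
/-- Mean value property on the unit circle, folded onto the upper half circle. -/
lemma integral_exp_add_exp_neg {g : ℂ → ℂ} (hg : DiffContOnCl ℂ g (ball 0 1)) :
    ∫ θ in (0 : ℝ)..Real.pi, (g (exp (θ * I)) + g (exp (-(θ * I)))) = 2 * Real.pi * g 0 := by
  have hcont : Continuous fun θ : ℝ => g (exp (θ * I)) := by
    refine hg.continuousOn_ball.comp_continuous (by fun_prop) fun θ => ?_
    simp [norm_exp_ofReal_mul_I]
  have hmean := DiffContOnCl.circleAverage (f := g) (c := 0) (R := 1) (by simpa using hg)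
  rw [Real.circleAverage_eq_integral_add (-Real.pi)] at hmean
  have hfold : ∫ θ in (0 : ℝ)..Real.pi, (g (exp (θ * I)) + g (exp (-(θ * I))))
      = ∫ θ in (-Real.pi)..Real.pi, g (exp (θ * I)) := by
    have hneg : ∫ θ in (0 : ℝ)..Real.pi, g (exp (-(θ * I)))
        = ∫ θ in (-Real.pi)..0, g (exp (θ * I)) := by
      simpa using intervalIntegral.integral_comp_neg (a := 0) (b := Real.pi)
        (fun θ : ℝ => g (exp (θ * I)))
    have hcont_neg : Continuous fun θ : ℝ => g (exp (-(θ * I))) := by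
      simpa [Function.comp_def] using hcont.comp continuous_neg
    rw [intervalIntegral.integral_add (hcont.intervalIntegrable _ _)
      (hcont_neg.intervalIntegrable _ _), hneg, add_comm,
      intervalIntegral.integral_add_adjacent_intervals (hcont.intervalIntegrable _ _)
        (hcont.intervalIntegrable _ _)]
  rw [hfold, ← hmean]
  have hshift := intervalIntegral.integral_comp_add_right (a := 0) (b := 2 * Real.pi)
    (fun θ : ℝ => g (exp (θ * I))) (-Real.pi)
  rw [zero_add, show 2 * Real.pi + -Real.pi = Real.pi by ring] at hshift
  simp only [circleMap, ofReal_one, one_mul, zero_add]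
  rw [hshift, real_smul]
  have : (Real.pi : ℂ) ≠ 0 := by exact_mod_cast Real.pi_ne_zero
  push_cast
  exact (mul_inv_cancel_left₀ (mul_ne_zero two_ne_zero this) _).symm

lemma one_sub_mul_ne_zero_of_norm_lt_one {w u : ℂ} (hw : ‖w‖ < 1) (hu : ‖u‖ ≤ 1) :
    1 - w * u ≠ 0 := by
  intro h
  have : ‖w * u‖ = 1 := by rw [← sub_eq_zero.mp h, norm_one]
  rw [norm_mul] at this
  nlinarith [norm_nonneg w, norm_nonneg u]

open Complex Metric in
lemma integral_sin_sq_div {w : ℂ} (hw : ‖w‖ < 1) :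
    ∫ θ in (0 : ℝ)..Real.pi, (Real.sin θ : ℂ) ^ 2 / (1 - 2 * w * Real.cos θ + w ^ 2)
      = (Real.pi : ℂ) / 2 := by
  have hdiff : DiffContOnCl ℂ (fun u => (1 - u ^ 2) / (4 * (1 - w * u))) (ball 0 1) := by
    refine DifferentiableOn.diffContOnCl fun u hu => ?_
    have hu' : ‖u‖ ≤ 1 := by simpa using closure_ball_subset_closedBall hu
    have := one_sub_mul_ne_zero_of_norm_lt_one hw hu'
    exact (DifferentiableAt.div (by fun_prop) (by fun_prop) (by simpa using this)
      ).differentiableWithinAt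
  have h := integral_exp_add_exp_neg hdiff
  rw [show (2 * Real.pi * ((1 - 0 ^ 2) / (4 * (1 - w * 0))) : ℂ) = Real.pi / 2 by
    norm_num; ring] at h
  rw [← h]
  refine intervalIntegral.integral_congr fun θ _ => ?_
  have hu : ‖exp (θ * I)‖ = 1 := norm_exp_ofReal_mul_I θ
  have hv : ‖exp (-(θ * I))‖ = 1 := by simpa using norm_exp_ofReal_mul_I (-θ)
  have hne₁ := one_sub_mul_ne_zero_of_norm_lt_one hw hu.le
  have hne₂ := one_sub_mul_ne_zero_of_norm_lt_one hw hv.le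
  have huv : exp (θ * I) * exp (-(θ * I)) = 1 := by rw [← exp_add]; simp
  have hcos : 2 * cos θ = exp (θ * I) + exp (-(θ * I)) := by
    rw [two_cos, neg_mul]
  have hsin : (2 * sin θ) ^ 2 = -(exp (θ * I) - exp (-(θ * I))) ^ 2 := by
    rw [two_sin, neg_mul, mul_pow, I_sq]; ring
  have hD : 1 - 2 * w * cos θ + w ^ 2
      = (1 - w * exp (θ * I)) * (1 - w * exp (-(θ * I))) := by
    linear_combination (-w) * hcos - w ^ 2 * huv
  simp only [ofReal_cos, ofReal_sin]
  rw [hD, show sin θ ^ 2 = (2 * sin θ) ^ 2 / 4 by ring, hsin]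
  generalize exp (θ * I) = u at *
  generalize exp (-(θ * I)) = v at *
  rw [mul_comm w u, mul_comm w v] at *
  field_simp
  linear_combination (2 - w * u - w * v) * huv

open Complex in
lemma msc_neg_add_inv {w : ℂ} (hw : ‖w‖ < 1) (him : (-(w + w⁻¹)).im ≠ 0) :
    msc (-(w + w⁻¹)) = w := by
  have hw0 : w ≠ 0 := by rintro rfl; simp at him
  set z := -(w + w⁻¹) with hz
  have hxz : ∀ x : ℝ, (x : ℂ) - z ≠ 0 := fun x h => him (by
    rw [← sub_eq_zero.mp h]; simp)
  have hcont : Continuous fun x : ℝ => (rhoSc x : ℂ) / ((x : ℂ) - z) := by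
    refine Continuous.div ?_ (by fun_prop) hxz
    unfold rhoSc
    fun_prop
  have hsub := intervalIntegral.integral_deriv_smul_comp (a := 0) (b := Real.pi)
    (f := fun θ : ℝ => -2 * Real.cos θ) (f' := fun θ => 2 * Real.sin θ)
    (fun θ _ => by simpa using (Real.hasDerivAt_cos θ).const_mul (-2)) (by fun_prop) hcont
  have hpi : (Real.pi : ℂ) ≠ 0 := by exact_mod_cast Real.pi_ne_zero
  simp only [Real.cos_zero, Real.cos_pi, mul_one, mul_neg, neg_neg] at hsub
  rw [msc, ← hsub]
  have hw2 : w = 2 * w / Real.pi * (Real.pi / 2) := by field_simp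
  conv_rhs => rw [hw2, ← integral_sin_sq_div hw, ← intervalIntegral.integral_const_mul]
  refine intervalIntegral.integral_congr fun θ hθ => ?_
  rw [Set.uIcc_of_le Real.pi_pos.le] at hθ
  have hrho : rhoSc (-2 * Real.cos θ) = Real.sin θ / Real.pi := by
    rw [rhoSc, show 4 - (-2 * Real.cos θ) ^ 2 = (2 * Real.sin θ) ^ 2 by
      nlinarith [Real.sin_sq_add_cos_sq θ],
      Real.sqrt_sq (by linarith [Real.sin_nonneg_of_mem_Icc hθ])]
    field_simp
  have hden : ((-2 * Real.cos θ : ℝ) : ℂ) - z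
      = (1 - 2 * w * Real.cos θ + w ^ 2) / w := by
    rw [hz]; push_cast; field_simp; ring
  simp only [Function.comp_apply, real_smul]
  rw [hrho, hden]
  push_cast
  have hne : 1 - 2 * w * cos θ + w ^ 2 ≠ 0 := by
    intro h
    apply hxz (-2 * Real.cos θ)
    rw [hden]; simp [h]
  field_simp

/-- The map `w ↦ -(w + w⁻¹)` takes the punctured unit disc onto a set containing all
nonreal numbers. -/
lemma exists_norm_lt_one_eq_neg_add_inv {z : ℂ} (hz : z.im ≠ 0) :
    ∃ w : ℂ, w ≠ 0 ∧ ‖w‖ < 1 ∧ z = -(w + w⁻¹) := by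
  obtain ⟨x, hx⟩ := exists_quadratic_eq_zero (a := (1 : ℂ)) (b := z) (c := 1) one_ne_zero
    (IsAlgClosed.exists_eq_mul_self _)
  have hx0 : x ≠ 0 := by rintro rfl; simp at hx
  have hzx : z = -(x + x⁻¹) := by
    field_simp
    linear_combination hx
  have hnorm : ‖x‖ ≠ 1 := by
    intro h
    rw [hzx, Complex.inv_eq_conj h, Complex.add_conj] at hz
    exact hz (by rw [Complex.neg_im, Complex.ofReal_im, neg_zero])
  rcases lt_or_gt_of_ne hnorm with h | h
  · exact ⟨x, hx0, h, hzx⟩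
  · exact ⟨x⁻¹, inv_ne_zero hx0, by rw [norm_inv]; exact inv_lt_one_of_one_lt₀ h,
      by rw [hzx, inv_inv, add_comm]⟩

lemma msc_spec {z : ℂ} (hz : z.im ≠ 0) :
    msc z ≠ 0 ∧ ‖msc z‖ < 1 ∧ z = -(msc z + (msc z)⁻¹) := by
  obtain ⟨w, hw0, hw, rfl⟩ := exists_norm_lt_one_eq_neg_add_inv hz
  rw [msc_neg_add_inv hw hz]
  exact ⟨hw0, hw, rfl⟩

lemma one_sub_msc_mul_msc_ne_zero {z₁ z₂ : ℂ} (h₁ : z₁.im ≠ 0) (h₂ : z₂.im ≠ 0) :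
    1 - msc z₁ * msc z₂ ≠ 0 :=
  one_sub_mul_ne_zero_of_norm_lt_one (msc_spec h₁).2.1 (msc_spec h₂).2.1.le

lemma sub_mul_msc_mul_msc_s14 {z₁ z₂ : ℂ} (h₁ : z₁.im ≠ 0) (h₂ : z₂.im ≠ 0) :
    (z₂ - z₁) * (msc z₁ * msc z₂) = (msc z₂ - msc z₁) * (1 - msc z₁ * msc z₂) := by
  obtain ⟨hm₁, -, e₁⟩ := msc_spec h₁
  obtain ⟨hm₂, -, e₂⟩ := msc_spec h₂
  generalize msc z₁ = m₁ at *
  generalize msc z₂ = m₂ at *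
  rw [e₁, e₂]
  field_simp
  ring

lemma eventually_im_ne_zero {z : ℂ} (hz : z.im ≠ 0) : ∀ᶠ y in nhds z, y.im ≠ 0 :=
  Complex.continuous_im.continuousAt.eventually_ne hz

lemma continuousAt_msc_s14 {z : ℂ} (hz : z.im ≠ 0) : ContinuousAt msc z := by
  obtain ⟨-, hlt, -⟩ := msc_spec hz
  have hbound : ∀ᶠ y in nhds z, ‖msc y - msc z‖ ≤ ‖y - z‖ / (1 - ‖msc z‖) := by
    filter_upwards [eventually_im_ne_zero hz] with y hy
    rw [le_div_iff₀ (by linarith)]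
    obtain ⟨-, hy1, -⟩ := msc_spec hy
    have hprod : ‖msc z * msc y‖ ≤ ‖msc z‖ := by
      rw [norm_mul]
      exact mul_le_of_le_one_right (norm_nonneg _) hy1.le
    have hlower : 1 - ‖msc z‖ ≤ ‖1 - msc z * msc y‖ := by
      have := norm_sub_norm_le (1 : ℂ) (msc z * msc y)
      rw [norm_one] at this
      linarith
    calc ‖msc y - msc z‖ * (1 - ‖msc z‖)
        ≤ ‖msc y - msc z‖ * ‖1 - msc z * msc y‖ := by gcongr
      _ = ‖y - z‖ * ‖msc z * msc y‖ := by
        rw [← norm_mul, ← sub_mul_msc_mul_msc_s14 hz hy, norm_mul]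
      _ ≤ ‖y - z‖ := mul_le_of_le_one_right (norm_nonneg _) (hprod.trans hlt.le)
  rw [ContinuousAt, tendsto_iff_norm_sub_tendsto_zero]
  refine squeeze_zero' (.of_forall fun _ => norm_nonneg _) hbound ?_
  have : ContinuousAt (fun y : ℂ => ‖y - z‖ / (1 - ‖msc z‖)) z := by fun_prop
  simpa [ContinuousAt] using this

lemma hasDerivAt_msc {z : ℂ} (hz : z.im ≠ 0) :
    HasDerivAt msc (msc z ^ 2 / (1 - msc z ^ 2)) z := by
  obtain ⟨h0, -, -⟩ := msc_spec hz
  have hne : 1 - msc z ^ 2 ≠ 0 := by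
    simpa [sq] using one_sub_msc_mul_msc_ne_zero hz hz
  have hf : HasDerivAt (fun w : ℂ => -(w + w⁻¹)) ((1 - msc z ^ 2) / msc z ^ 2) (msc z) := by
    convert! ((hasDerivAt_id (msc z)).add (hasDerivAt_inv h0)).neg using 1
    field_simp
    ring
  have := hf.of_local_left_inverse (continuousAt_msc_s14 hz)
    (div_ne_zero hne (pow_ne_zero _ h0))
    ((eventually_im_ne_zero hz).mono fun y hy => (msc_spec hy).2.2.symm)
  rwa [inv_div] at this

lemma iteratedDeriv_two_msc {z : ℂ} (hz : z.im ≠ 0) :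
    iteratedDeriv 2 msc z = 2 * msc z ^ 3 / (1 - msc z ^ 2) ^ 3 := by
  have hne : 1 - msc z ^ 2 ≠ 0 := by
    simpa [sq] using one_sub_msc_mul_msc_ne_zero hz hz
  have hev : deriv msc =ᶠ[nhds z] fun y => msc y ^ 2 / (1 - msc y ^ 2) :=
    (eventually_im_ne_zero hz).mono fun y hy => (hasDerivAt_msc hy).deriv
  rw [iteratedDeriv_succ, iteratedDeriv_one, hev.deriv_eq]
  have hsq := (hasDerivAt_msc hz).pow 2
  have hquot := hsq.div (hsq.const_sub 1) hne
  refine HasDerivAt.deriv (hquot.congr_deriv ?_)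
  simp only [Pi.pow_apply]
  field_simp
  ring

/-- Setting `σ = ω̃₂ = 0` and applying the covariance recursion once (with prefactor
`m₁/(1 - m₁²)` and source terms `s_GUE = m[1,2,2]`, `s_κ = κ₄ m₁² m₂ m₂'`) yields the closed
formula `m[z₁|z₂] = m₁'m₂'/(1 - m₁m₂)² + κ₄ m₁ m₁' m₂ m₂'`. -/
theorem cov_recursion_once (z₁ z₂ κ₄ : ℂ) (h₁ : z₁.im ≠ 0) (h₂ : z₂.im ≠ 0)
    (dd : List ℂ → ℂ)
    (hone : ∀ w : ℂ, dd [w] = msc w)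
    (hrec : ∀ (l : List ℂ) (a b : ℂ), a ∈ l → b ∈ l → a ≠ b →
      dd l = (dd (l.erase a) - dd (l.erase b)) / (b - a))
    (hrep : ∀ (w : ℂ) (m : ℕ),
      dd (List.replicate (m + 1) w) = iteratedDeriv m msc w / (m.factorial : ℂ)) :
    msc z₁ / (1 - msc z₁ ^ 2) *
        (dd [z₁, z₂, z₂] + κ₄ * msc z₁ ^ 2 * msc z₂ * deriv msc z₂) =
      deriv msc z₁ * deriv msc z₂ / (1 - msc z₁ * msc z₂) ^ 2 +
        κ₄ * msc z₁ * deriv msc z₁ * msc z₂ * deriv msc z₂ := by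
  obtain ⟨hm₁, -, -⟩ := msc_spec h₁
  obtain ⟨hm₂, -, -⟩ := msc_spec h₂
  have hne₁ : 1 - msc z₁ ^ 2 ≠ 0 := by
    simpa [sq] using one_sub_msc_mul_msc_ne_zero h₁ h₁
  have hne₂ : 1 - msc z₂ ^ 2 ≠ 0 := by
    simpa [sq] using one_sub_msc_mul_msc_ne_zero h₂ h₂
  have hne₁₂ := one_sub_msc_mul_msc_ne_zero h₁ h₂
  have hdd : dd [z₁, z₂, z₂]
      = msc z₁ * msc z₂ ^ 2 / ((1 - msc z₂ ^ 2) * (1 - msc z₁ * msc z₂) ^ 2) := by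
    rcases eq_or_ne z₁ z₂ with rfl | hz
    · have := hrep z₁ 2
      rw [iteratedDeriv_two_msc h₁] at this
      simp only [List.replicate, Nat.factorial] at this
      rw [this]
      push_cast
      field_simp
    · have hd : dd [z₂, z₂] = msc z₂ ^ 2 / (1 - msc z₂ ^ 2) := by
        simpa [List.replicate, (hasDerivAt_msc h₂).deriv] using hrep z₂ 1
      have hpair := hrec [z₁, z₂] z₁ z₂ (by simp) (by simp) hz
      have htriple := hrec [z₁, z₂, z₂] z₁ z₂ (by simp) (by simp) hz
      simp only [List.erase_cons_head, List.erase_cons_tail, beq_iff_eq, hz, not_false_eq_true,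
        hone] at hpair htriple
      have hsub : z₂ - z₁ ≠ 0 := sub_ne_zero.mpr hz.symm
      have key := sub_mul_msc_mul_msc_s14 h₁ h₂
      have hpair' : dd [z₁, z₂] = msc z₁ * msc z₂ / (1 - msc z₁ * msc z₂) := by
        rw [hpair, div_eq_div_iff hsub hne₁₂]
        linear_combination -key
      rw [htriple, hd, hpair']
      have hne₂₁ := one_sub_msc_mul_msc_ne_zero h₂ h₁
      field_simp
      linear_combination -key
  rw [hdd, (hasDerivAt_msc h₁).deriv, (hasDerivAt_msc h₂).deriv]
  field_simp
end
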